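/- arXiv:2107.07070 — 2 statements merged into one kernel-verified Lean document; each statement's English description precedes it below -/
import Mathlib

section
/- There exists an absolute constant c > 0 with the following property. Let (u₁, N₁, p₁) and (u₂, N₂, p₂) be two classical solutions of the damped Navier–Stokes–Bardina equations with the same force f and initial data u_{0,1}, u_{0,2}. Then for all t ≥ 0: ‖u₁(t,·) − u₂(t,·)‖²_{H¹_α} ≤ ‖u_{0,1} − u_{0,2}‖²_{H¹_α} · exp( (c/ν) ∫₀ᵗ ‖u₁(s,·)‖_{Ḣ¹} ‖u₁(s,·)‖_{Ḣ²} ds ). -/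
open MeasureTheory Set

noncomputable section

abbrev V3 : Type := Fin 3 → ℝ

def pd (j : Fin 3) (g : V3 → Fin 3 → ℝ) : V3 → Fin 3 → ℝ :=
  fun x => fderiv ℝ g x (Pi.single j 1)

def pdS (j : Fin 3) (g : V3 → ℝ) : V3 → ℝ :=
  fun x => fderiv ℝ g x (Pi.single j 1)

def L2sq (g : V3 → Fin 3 → ℝ) : ℝ := ∫ x : V3, ∑ i, (g x i)^2
def H1sq (g : V3 → Fin 3 → ℝ) : ℝ := ∫ x : V3, ∑ i, ∑ j, (pd j g x i)^2
def H2sq (g : V3 → Fin 3 → ℝ) : ℝ := ∫ x : V3, ∑ i, ∑ j, ∑ k, (pd k (pd j g) x i)^2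
def H1aSq (α : ℝ) (g : V3 → Fin 3 → ℝ) : ℝ := L2sq g + α^2 * H1sq g

def IsSchwartz {F : Type*} [NormedAddCommGroup F] [NormedSpace ℝ F] (g : V3 → F) : Prop :=
  ContDiff ℝ (⊤ : ℕ∞) g ∧ ∀ (k n : ℕ), ∃ C : ℝ, ∀ x : V3, ‖x‖ ^ k * ‖iteratedFDeriv ℝ n g x‖ ≤ C

def IsForce (f : V3 → Fin 3 → ℝ) : Prop :=
  IsSchwartz f ∧ ∀ x, (∑ j, pd j f x j) = 0

def SchwartzLocBdd {F : Type*} [NormedAddCommGroup F] [NormedSpace ℝ F]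
    (g : ℝ → V3 → F) : Prop :=
  ContDiffOn ℝ (⊤ : ℕ∞) (fun q : ℝ × V3 => g q.1 q.2) (Set.Ici (0:ℝ) ×ˢ Set.univ) ∧
  ∀ T > (0:ℝ), ∀ (k n : ℕ), ∃ C : ℝ, ∀ t ∈ Set.Icc (0:ℝ) T, ∀ x : V3,
    ‖x‖ ^ k * ‖iteratedFDeriv ℝ n (g t) x‖ ≤ C

structure ClassicalSolution (α β ν : ℝ) (u₀ f : V3 → Fin 3 → ℝ) where
  u : ℝ → V3 → Fin 3 → ℝ
  N : ℝ → V3 → Fin 3 → ℝ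
  p : ℝ → V3 → ℝ
  reg_u : SchwartzLocBdd u
  reg_N : SchwartzLocBdd N
  reg_p : SchwartzLocBdd p
  divFree : ∀ t ≥ (0:ℝ), ∀ x, (∑ j, pd j (u t) x j) = 0
  filter : ∀ t ≥ (0:ℝ), ∀ x i, -α^2 * (∑ j, pd j (pd j (N t)) x i) + N t x i
      = ∑ j, u t x j * pd j (u t) x i
  momentum : ∀ t ≥ (0:ℝ), ∀ x i,
      derivWithin (fun s => u s x i) (Set.Ici (0:ℝ)) t + N t x i
        - ν * (∑ j, pd j (pd j (u t)) x i) + pdS i (p t) x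
      = f x i - β * u t x i
  init : ∀ x, u 0 x = u₀ x


/-- Continuous functions on `V3` bounded by a multiple of `(1 + ‖x‖) ^ (-4)`. -/
def IsDecaying (g : V3 → ℝ) : Prop :=
  Continuous g ∧ ∃ C : ℝ, ∀ x, |g x| ≤ C * (1 + ‖x‖) ^ (-4 : ℝ)

/-- `C¹` functions which decay together with their first derivatives. -/
def IsDecayingC1 (g : V3 → ℝ) : Prop :=
  ContDiff ℝ 1 g ∧ IsDecaying g ∧ ∀ j, IsDecaying (pdS j g)

lemma decayWeight_le_one {E : Type*} [NormedAddCommGroup E] (x : E) :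
    (1 + ‖x‖) ^ (-4 : ℝ) ≤ 1 :=
  Real.rpow_le_one_of_one_le_of_nonpos (by linarith [norm_nonneg x]) (by norm_num)

lemma decayWeight_pos {E : Type*} [NormedAddCommGroup E] (x : E) :
    0 < (1 + ‖x‖) ^ (-4 : ℝ) := by positivity

lemma integrable_decayWeight : Integrable (fun x : V3 => (1 + ‖x‖) ^ (-4 : ℝ)) :=
  integrable_one_add_norm (by simp; norm_num)

lemma nonneg_of_abs_le_mul_decayWeight {E : Type*} [NormedAddCommGroup E] {a C : ℝ} {x : E}
    (h : |a| ≤ C * (1 + ‖x‖) ^ (-4 : ℝ)) : 0 ≤ C :=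
  nonneg_of_mul_nonneg_left ((abs_nonneg a).trans h) (decayWeight_pos x)

lemma abs_mul_le_decayWeight {E : Type*} [NormedAddCommGroup E] {a b C D : ℝ} {x : E}
    (ha : |a| ≤ C * (1 + ‖x‖) ^ (-4 : ℝ)) (hb : |b| ≤ D * (1 + ‖x‖) ^ (-4 : ℝ)) :
    |a * b| ≤ C * D * (1 + ‖x‖) ^ (-4 : ℝ) := by
  have hC := nonneg_of_abs_le_mul_decayWeight ha
  have hD := nonneg_of_abs_le_mul_decayWeight hb
  have hb' : |b| ≤ D := hb.trans (mul_le_of_le_one_right hD (decayWeight_le_one x))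
  rw [abs_mul]
  calc |a| * |b| ≤ C * (1 + ‖x‖) ^ (-4 : ℝ) * D := by gcongr
    _ = _ := by ring

namespace IsDecaying

variable {g h : V3 → ℝ}

lemma integrable (hg : IsDecaying g) : Integrable g := by
  obtain ⟨hc, C, hC⟩ := hg
  exact (integrable_decayWeight.const_mul C).mono' hc.aestronglyMeasurable (.of_forall hC)

lemma add (hg : IsDecaying g) (hh : IsDecaying h) : IsDecaying (fun x => g x + h x) := by
  obtain ⟨hc, C, hC⟩ := hg
  obtain ⟨hd, D, hD⟩ := hh
  refine ⟨hc.add hd, C + D, fun x => ?_⟩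
  linarith [abs_add_le (g x) (h x), hC x, hD x]

lemma mul (hg : IsDecaying g) (hh : IsDecaying h) : IsDecaying (fun x => g x * h x) := by
  obtain ⟨hc, C, hC⟩ := hg
  obtain ⟨hd, D, hD⟩ := hh
  exact ⟨hc.mul hd, C * D, fun x => abs_mul_le_decayWeight (hC x) (hD x)⟩

lemma const_mul (a : ℝ) (hg : IsDecaying g) : IsDecaying (fun x => a * g x) := by
  obtain ⟨hc, C, hC⟩ := hg
  refine ⟨hc.const_mul a, |a| * C, fun x => ?_⟩
  rw [abs_mul, mul_assoc]
  exact mul_le_mul_of_nonneg_left (hC x) (abs_nonneg a)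

lemma abs (hg : IsDecaying g) : IsDecaying (fun x => |g x|) := by
  obtain ⟨hc, C, hC⟩ := hg
  exact ⟨hc.abs, C, fun x => by simpa using hC x⟩

lemma pow (hg : IsDecaying g) : ∀ n : ℕ, IsDecaying (fun x => g x ^ (n + 1))
  | 0 => by simpa using hg
  | n + 1 => by simpa only [pow_succ _ (n + 1)] using (hg.pow n).mul hg

lemma sq (hg : IsDecaying g) : IsDecaying (fun x => g x ^ 2) := hg.pow 1

lemma sum {ι : Type*} {s : Finset ι} {g : ι → V3 → ℝ} (hg : ∀ i ∈ s, IsDecaying (g i)) :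
    IsDecaying (fun x => ∑ i ∈ s, g i x) := by
  classical
  induction s using Finset.induction_on with
  | empty => exact ⟨by simpa using continuous_const, 0, by simp⟩
  | insert a s ha ih =>
    simp only [Finset.sum_insert ha]
    exact (hg a (by simp)).add (ih fun i hi => hg i (by simp [hi]))

end IsDecaying

lemma sq_integral_mul_le {X : Type*} [MeasurableSpace X] {μ : Measure X} {f g : X → ℝ}
    (hf : Integrable (fun x => f x ^ 2) μ) (hg : Integrable (fun x => g x ^ 2) μ)
    (hfg : Integrable (fun x => f x * g x) μ) :
    (∫ x, f x * g x ∂μ) ^ 2 ≤ (∫ x, f x ^ 2 ∂μ) * ∫ x, g x ^ 2 ∂μ := by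
  have key : ∀ t : ℝ, 0 ≤ (∫ x, g x ^ 2 ∂μ) * (t * t) + (2 * ∫ x, f x * g x ∂μ) * t
      + ∫ x, f x ^ 2 ∂μ := by
    intro t
    have h : 0 ≤ ∫ x, (f x + t * g x) ^ 2 ∂μ := integral_nonneg fun x => sq_nonneg _
    have e : (fun x => (f x + t * g x) ^ 2)
        = fun x => (t * t) * g x ^ 2 + (2 * t) * (f x * g x) + f x ^ 2 := by
      ext x; ring
    rw [e, integral_add (f := fun x => (t * t) * g x ^ 2 + (2 * t) * (f x * g x))
      ((hg.const_mul _).add (hfg.const_mul _)) hf,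
      integral_add (hg.const_mul _) (hfg.const_mul _), integral_const_mul,
      integral_const_mul] at h
    linarith
  have := discrim_le_zero key
  rw [discrim] at this
  nlinarith

lemma tendsto_decayWeight_atBot :
    Filter.Tendsto (fun s : ℝ => (1 + ‖s‖) ^ (-4 : ℝ)) Filter.atBot (nhds 0) := by
  refine (tendsto_rpow_neg_atTop (y := 4) (by norm_num)).comp ?_
  exact Filter.tendsto_atTop_add_const_left _ 1 Filter.tendsto_abs_atBot_atTop

lemma decayWeight_update_le (x : V3) (i : Fin 3) (s : ℝ) :
    (1 + ‖Function.update x i s‖) ^ (-4 : ℝ) ≤ (1 + ‖s‖) ^ (-4 : ℝ) := by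
  have h : ‖s‖ ≤ ‖Function.update x i s‖ := by
    simpa using norm_le_pi_norm (Function.update x i s) i
  exact Real.rpow_le_rpow_of_nonpos (by positivity) (by linarith) (by norm_num)

lemma IsDecayingC1.pow_succ {g : V3 → ℝ} (hg : IsDecayingC1 g) (n : ℕ) :
    IsDecayingC1 (fun x => g x ^ (n + 2)) := by
  refine ⟨hg.1.pow _, hg.2.1.pow _, fun j => ?_⟩
  have : pdS j (fun x => g x ^ (n + 2)) = fun x => (n + 2 : ℕ) * (g x ^ (n + 1) * pdS j g x) := by
    ext x
    have := ((hg.1.differentiable one_ne_zero x).hasFDerivAt.pow (n + 2)).fderiv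
    simp only [pdS]
    rw [this]
    simp
    ring
  rw [this]
  exact ((hg.2.1.pow n).mul (hg.2.2 j)).const_mul _

/-- The fundamental theorem of calculus along a coordinate line. -/
lemma IsDecayingC1.ofReal_abs_le_lintegral {g : V3 → ℝ} (hg : IsDecayingC1 g) (x : V3)
    (i : Fin 3) :
    ENNReal.ofReal |g x| ≤ ∫⁻ s, ENNReal.ofReal |pdS i g (Function.update x i s)| := by
  obtain ⟨hd, ⟨-, C, hC⟩, hp⟩ := hg
  obtain ⟨hpc, D, hD⟩ := hp i
  have hC0 := nonneg_of_abs_le_mul_decayWeight (hC x)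
  have hD0 := nonneg_of_abs_le_mul_decayWeight (hD x)
  have hder : ∀ s, HasDerivAt (fun s => g (Function.update x i s))
      (pdS i g (Function.update x i s)) s := fun s =>
    (hd.differentiable one_ne_zero _).hasFDerivAt.comp_hasDerivAt s (hasDerivAt_update x i s)
  have hint : Integrable (fun s => pdS i g (Function.update x i s)) := by
    have h1 : Integrable (fun s : ℝ => (1 + ‖s‖) ^ (-4 : ℝ)) :=
      integrable_one_add_norm (by simp)
    refine (h1.const_mul D).mono' ?_ (.of_forall fun s => ?_)
    · exact (hpc.comp (continuous_const.update i continuous_id)).aestronglyMeasurable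
    · exact (hD _).trans (by gcongr ?_ * ?_; exact decayWeight_update_le x i s)
  have hlim : Filter.Tendsto (fun s => g (Function.update x i s)) Filter.atBot (nhds 0) := by
    refine squeeze_zero_norm (a := fun s => C * (1 + ‖s‖) ^ (-4 : ℝ)) (fun s => ?_) ?_
    · exact (hC _).trans (by gcongr ?_ * ?_; exact decayWeight_update_le x i s)
    · simpa using tendsto_decayWeight_atBot.const_mul C
  have h := integral_Iic_of_hasDerivAt_of_tendsto' (a := x i) (fun s _ => hder s)
    hint.integrableOn hlim
  rw [Function.update_eq_self, sub_zero] at h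
  have e : ∀ a : ℝ, ENNReal.ofReal |a| = ‖a‖ₑ := fun a => by
    rw [← Real.norm_eq_abs, ofReal_norm]
  simp only [e]
  rw [← h]
  exact (enorm_integral_le_lintegral_enorm _).trans
    (lintegral_mono' Measure.restrict_le_self le_rfl)

lemma IsDecayingC1.sq_integral_pow_six_le {b : V3 → ℝ} (hb : IsDecayingC1 b) :
    (∫ x, b x ^ 6) ^ 2 ≤ (∫ x, ∑ j, |pdS j (fun y => b y ^ 4) x|) ^ 3 := by
  have h4 : IsDecayingC1 (fun y => b y ^ 4) := hb.pow_succ 2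
  set f : V3 → ℝ := fun x => ∑ j, |pdS j (fun y => b y ^ 4) x| with hf
  have hfd : IsDecaying f := IsDecaying.sum fun j _ => (h4.2.2 j).abs
  have hf0 : ∀ x, 0 ≤ f x := fun x => Finset.sum_nonneg fun j _ => abs_nonneg _
  have hline : ∀ x i, ENNReal.ofReal (b x ^ 2)
      ≤ (∫⁻ s, ENNReal.ofReal (f (Function.update x i s)))
        ^ ((1 : ℝ) / (Fintype.card (Fin 3) - 1 : ℝ)) := by
    intro x i
    have h1 : ENNReal.ofReal (b x ^ 4) ≤ ∫⁻ s, ENNReal.ofReal (f (Function.update x i s)) := by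
      have := h4.ofReal_abs_le_lintegral x i
      rw [abs_of_nonneg (by positivity)] at this
      refine this.trans (lintegral_mono fun s => ENNReal.ofReal_le_ofReal ?_)
      exact Finset.single_le_sum (f := fun j => |pdS j (fun y => b y ^ 4) (Function.update x i s)|)
        (fun j _ => abs_nonneg _) (Finset.mem_univ i)
    have h2 : ENNReal.ofReal (b x ^ 2)
        = ENNReal.ofReal (b x ^ 4) ^ ((1 : ℝ) / (Fintype.card (Fin 3) - 1 : ℝ)) := by
      rw [ENNReal.ofReal_rpow_of_nonneg (by positivity) (by norm_num)]
      congr 1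
      have : b x ^ 4 = (b x ^ 2) ^ (2 : ℝ) := by norm_cast; ring
      rw [this, ← Real.rpow_mul (by positivity)]
      norm_num
    rw [h2]
    exact ENNReal.rpow_le_rpow h1 (by norm_num)
  have hconj : Real.HolderConjugate (Fintype.card (Fin 3)) (3 / 2) := by
    rw [Real.holderConjugate_iff]; norm_num
  have hgrid := lintegral_prod_lintegral_pow_le (fun _ : Fin 3 => (volume : Measure ℝ)) hconj
    (f := fun x => ENNReal.ofReal (f x)) hfd.1.measurable.ennreal_ofReal
  have hmono : ∫⁻ x, ENNReal.ofReal (b x ^ 6) ≤ (∫⁻ x, ENNReal.ofReal (f x)) ^ (3 / 2 : ℝ) := by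
    refine le_trans (lintegral_mono fun x => ?_) hgrid
    calc ENNReal.ofReal (b x ^ 6) = ∏ _i : Fin 3, ENNReal.ofReal (b x ^ 2) := by
          rw [Finset.prod_const, ← ENNReal.ofReal_pow (by positivity)]
          congr 1
          simp
          ring
      _ ≤ _ := Finset.prod_le_prod' fun i _ => hline x i
  have hI0 : 0 ≤ ∫ x, f x := integral_nonneg hf0
  rw [← ofReal_integral_eq_lintegral_ofReal (hb.2.1.pow 5).integrable
      (.of_forall fun x => (by decide : Even 6).pow_nonneg (b x)),
    ← ofReal_integral_eq_lintegral_ofReal hfd.integrable (.of_forall hf0),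
    ENNReal.ofReal_rpow_of_nonneg hI0 (by norm_num),
    ENNReal.ofReal_le_ofReal_iff (by positivity)] at hmono
  calc (∫ x, b x ^ 6) ^ 2 ≤ ((∫ x, f x) ^ (3 / 2 : ℝ)) ^ 2 := by
        gcongr
    _ = (∫ x, f x) ^ 3 := by
        rw [← Real.rpow_natCast, ← Real.rpow_mul hI0]
        norm_num

/-- The Sobolev inequality `‖b‖_{L⁶} ≲ ‖∇b‖_{L²}` in dimension three. -/
lemma IsDecayingC1.integral_pow_six_le {b : V3 → ℝ} (hb : IsDecayingC1 b) :
    ∫ x, b x ^ 6 ≤ 48 ^ 3 * (∑ j, ∫ x, pdS j b x ^ 2) ^ 3 := by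
  have hS0 : 0 ≤ ∫ x, b x ^ 6 := integral_nonneg fun x => by positivity
  have hD0 : ∀ j, 0 ≤ ∫ x, pdS j b x ^ 2 := fun j => integral_nonneg fun x => by positivity
  have hder : ∀ j x, |pdS j (fun y => b y ^ 4) x| = 4 * (|b x ^ 3| * |pdS j b x|) := by
    intro j x
    have := ((hb.1.differentiable one_ne_zero x).hasFDerivAt.pow 4).fderiv
    simp only [pdS]
    rw [this]
    simp [abs_mul]
    ring
  have hb3 : IsDecaying (fun x => |b x ^ 3|) := (hb.2.1.pow 2).abs
  have hcs : ∀ j, (∫ x, |b x ^ 3| * |pdS j b x|) ^ 2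
      ≤ (∫ x, b x ^ 6) * ∫ x, pdS j b x ^ 2 := by
    intro j
    have h := sq_integral_mul_le (μ := volume) (f := fun x => |b x ^ 3|)
      (g := fun x => |pdS j b x|) hb3.sq.integrable (hb.2.2 j).abs.sq.integrable
      (hb3.mul (hb.2.2 j).abs).integrable
    simpa only [sq_abs, ← pow_mul] using h
  have hI : ∫ x, ∑ j, |pdS j (fun y => b y ^ 4) x|
      = 4 * ∑ j, ∫ x, |b x ^ 3| * |pdS j b x| := by
    simp only [hder]
    rw [integral_finsetSum _ fun j _ =>
      ((hb3.mul (hb.2.2 j).abs).const_mul 4).integrable]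
    simp only [integral_const_mul, Finset.mul_sum]
  have h1 := hb.sq_integral_pow_six_le
  rw [hI] at h1
  set S := ∫ x, b x ^ 6
  set D := ∑ j, ∫ x, pdS j b x ^ 2 with hD
  set J := ∑ j, ∫ x, |b x ^ 3| * |pdS j b x|
  have hD0' : 0 ≤ D := Finset.sum_nonneg fun j _ => hD0 j
  have hJ2 : J ^ 2 ≤ 3 * (S * D) := by
    have := sq_sum_le_card_mul_sum_sq (s := Finset.univ)
      (f := fun j : Fin 3 => ∫ x, |b x ^ 3| * |pdS j b x|)
    refine this.trans ?_
    rw [hD, Finset.mul_sum (a := S)]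
    simp only [Finset.card_univ, Fintype.card_fin, Nat.cast_ofNat]
    gcongr with j
    exact hcs j
  rcases hS0.eq_or_lt with h | h
  · rw [← h]; positivity
  · have h2 : S ^ 4 ≤ (48 * (S * D)) ^ 3 := by
      calc S ^ 4 = (S ^ 2) ^ 2 := by ring
        _ ≤ ((4 * J) ^ 3) ^ 2 := by gcongr
        _ = (16 * J ^ 2) ^ 3 := by ring
        _ ≤ (16 * (3 * (S * D))) ^ 3 := by gcongr
        _ = _ := by ring
    have h3 : S ^ 3 * S ≤ S ^ 3 * (48 ^ 3 * D ^ 3) := by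
      calc S ^ 3 * S = S ^ 4 := by ring
        _ ≤ _ := h2
        _ = _ := by ring
    exact le_of_mul_le_mul_left h3 (by positivity)

/-- A trilinear estimate by Hölder's inequality with exponents `2`, `6`, `3`, interpolation of
`L³` between `L²` and `L⁶`, and the Sobolev inequality. -/
lemma pow_four_integral_mul_mul_le {a b g : V3 → ℝ} (ha : IsDecaying a) (hb : IsDecayingC1 b)
    (hg : IsDecayingC1 g) :
    (∫ x, a x * b x * g x) ^ 4 ≤ (∫ x, a x ^ 2) ^ 2 * (48 ^ 3 * (∫ x, g x ^ 2) *
      ((∑ j, ∫ x, pdS j b x ^ 2) ^ 2 * ∑ j, ∫ x, pdS j g x ^ 2)) := by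
  have hb1 := hb.2.1
  have hg1 := hg.2.1
  have hSb := hb.integral_pow_six_le
  have hSg := hg.integral_pow_six_le
  have hB0 : 0 ≤ ∑ j, ∫ x, pdS j b x ^ 2 :=
    Finset.sum_nonneg fun j _ => integral_nonneg fun x => by positivity
  have hG0 : 0 ≤ ∑ j, ∫ x, pdS j g x ^ 2 :=
    Finset.sum_nonneg fun j _ => integral_nonneg fun x => by positivity
  set B := ∑ j, ∫ x, pdS j b x ^ 2
  set G := ∑ j, ∫ x, pdS j g x ^ 2
  have hP0 : 0 ≤ ∫ x, (b x ^ 2 * g x) ^ 2 := integral_nonneg fun x => by positivity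
  have c1 : (∫ x, a x * (b x * g x)) ^ 2 ≤ (∫ x, a x ^ 2) * ∫ x, (b x * g x) ^ 2 :=
    sq_integral_mul_le ha.sq.integrable (hb1.mul hg1).sq.integrable
      (ha.mul (hb1.mul hg1)).integrable
  have c2 : (∫ x, g x * (b x ^ 2 * g x)) ^ 2 ≤ (∫ x, g x ^ 2) * ∫ x, (b x ^ 2 * g x) ^ 2 :=
    sq_integral_mul_le hg1.sq.integrable (hb1.sq.mul hg1).sq.integrable
      (hg1.mul (hb1.sq.mul hg1)).integrable
  have c3 : (∫ x, b x ^ 3 * (b x * g x ^ 2)) ^ 2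
      ≤ (∫ x, (b x ^ 3) ^ 2) * ∫ x, (b x * g x ^ 2) ^ 2 :=
    sq_integral_mul_le (hb1.pow 2).sq.integrable (hb1.mul hg1.sq).sq.integrable
      ((hb1.pow 2).mul (hb1.mul hg1.sq)).integrable
  have c4 : (∫ x, g x ^ 3 * (b x ^ 2 * g x)) ^ 2
      ≤ (∫ x, (g x ^ 3) ^ 2) * ∫ x, (b x ^ 2 * g x) ^ 2 :=
    sq_integral_mul_le (hg1.pow 2).sq.integrable (hb1.sq.mul hg1).sq.integrable
      ((hg1.pow 2).mul (hb1.sq.mul hg1)).integrable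
  have e1 : ∀ x, a x * (b x * g x) = a x * b x * g x := fun x => by ring
  have e2 : ∀ x, g x * (b x ^ 2 * g x) = (b x * g x) ^ 2 := fun x => by ring
  have e3 : ∀ x, b x ^ 3 * (b x * g x ^ 2) = (b x ^ 2 * g x) ^ 2 := fun x => by ring
  have e4 : ∀ x, g x ^ 3 * (b x ^ 2 * g x) = (b x * g x ^ 2) ^ 2 := fun x => by ring
  have e5 : ∀ x, (b x ^ 3) ^ 2 = b x ^ 6 := fun x => by ring
  have e6 : ∀ x, (g x ^ 3) ^ 2 = g x ^ 6 := fun x => by ring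
  simp only [e1] at c1
  simp only [e2] at c2
  simp only [e3, e5] at c3
  simp only [e4, e6] at c4
  have hQ0 : 0 ≤ ∫ x, (b x * g x ^ 2) ^ 2 := integral_nonneg fun x => by positivity
  have hR0 : 0 ≤ ∫ x, (b x * g x) ^ 2 := integral_nonneg fun x => by positivity
  have hA0 : 0 ≤ ∫ x, a x ^ 2 := integral_nonneg fun x => by positivity
  have hg0 : 0 ≤ ∫ x, g x ^ 2 := integral_nonneg fun x => by positivity
  have hSb0 : 0 ≤ ∫ x, b x ^ 6 := integral_nonneg fun x => by positivity
  set P := ∫ x, (b x ^ 2 * g x) ^ 2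
  set Q := ∫ x, (b x * g x ^ 2) ^ 2
  have hP : P ≤ 48 ^ 3 * (B ^ 2 * G) := by
    rcases hP0.eq_or_lt with h | h
    · rw [← h]; positivity
    · have h1 : P * P ^ 3 ≤ P * (48 ^ 3 * (B ^ 2 * G)) ^ 3 := by
        calc P * P ^ 3 = (P ^ 2) ^ 2 := by ring
          _ ≤ ((48 ^ 3 * B ^ 3) * Q) ^ 2 := by gcongr; exact c3.trans (by gcongr)
          _ = (48 ^ 3 * B ^ 3) ^ 2 * Q ^ 2 := by ring
          _ ≤ (48 ^ 3 * B ^ 3) ^ 2 * ((48 ^ 3 * G ^ 3) * P) := by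
            gcongr; exact c4.trans (by gcongr)
          _ = _ := by ring
      exact le_of_pow_le_pow_left₀ three_ne_zero (by positivity) (le_of_mul_le_mul_left h1 h)
  calc (∫ x, a x * b x * g x) ^ 4 = ((∫ x, a x * b x * g x) ^ 2) ^ 2 := by ring
    _ ≤ ((∫ x, a x ^ 2) * ∫ x, (b x * g x) ^ 2) ^ 2 := by gcongr
    _ = (∫ x, a x ^ 2) ^ 2 * (∫ x, (b x * g x) ^ 2) ^ 2 := by ring
    _ ≤ (∫ x, a x ^ 2) ^ 2 * ((∫ x, g x ^ 2) * (48 ^ 3 * (B ^ 2 * G))) := by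
      gcongr; exact c2.trans (by gcongr)
    _ = _ := by ring

/-- Integration by parts for decaying functions. -/
lemma IsDecayingC1.integral_mul_pdS {f g : V3 → ℝ} (hf : IsDecayingC1 f) (hg : IsDecayingC1 g)
    (j : Fin 3) : ∫ x, f x * pdS j g x = -∫ x, pdS j f x * g x :=
  integral_mul_fderiv_eq_neg_fderiv_mul_of_integrable ((hf.2.2 j).mul hg.2.1).integrable
    (hf.2.1.mul (hg.2.2 j)).integrable (hf.2.1.mul hg.2.1).integrable
    (fun x _ => hf.1.differentiable one_ne_zero x) (fun x _ => hg.1.differentiable one_ne_zero x)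

/-- Space-time functions, continuous up to the initial time, whose decay in space is locally
uniform in time. -/
def LocDecaying (g : ℝ → V3 → ℝ) : Prop :=
  ContinuousOn (fun q : ℝ × V3 => g q.1 q.2) (Ici (0 : ℝ) ×ˢ univ) ∧
  ∀ T > (0 : ℝ), ∃ C : ℝ, ∀ t ∈ Icc (0 : ℝ) T, ∀ x, |g t x| ≤ C * (1 + ‖x‖) ^ (-4 : ℝ)

namespace LocDecaying

variable {g h : ℝ → V3 → ℝ}

lemma isDecaying (hg : LocDecaying g) {t : ℝ} (ht : 0 ≤ t) : IsDecaying (g t) := by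
  obtain ⟨C, hC⟩ := hg.2 (t + 1) (by linarith)
  refine ⟨?_, C, hC t ⟨ht, by linarith⟩⟩
  rw [← continuousOn_univ]
  exact hg.1.comp (f := fun x => (t, x)) (by fun_prop) fun x _ => ⟨ht, mem_univ x⟩

lemma continuousOn_apply (hg : LocDecaying g) (x : V3) :
    ContinuousOn (fun t => g t x) (Ici 0) :=
  hg.1.comp (f := fun t => (t, x)) (by fun_prop) fun _ ht => ⟨ht, mem_univ x⟩

lemma mul (hg : LocDecaying g) (hh : LocDecaying h) :
    LocDecaying (fun t x => g t x * h t x) := by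
  refine ⟨hg.1.mul hh.1, fun T hT => ?_⟩
  obtain ⟨C, hC⟩ := hg.2 T hT
  obtain ⟨D, hD⟩ := hh.2 T hT
  exact ⟨C * D, fun t ht x => abs_mul_le_decayWeight (hC t ht x) (hD t ht x)⟩

lemma sq (hg : LocDecaying g) : LocDecaying (fun t x => g t x ^ 2) := by
  simpa only [_root_.sq] using hg.mul hg

lemma continuousOn_integral (hg : LocDecaying g) :
    ContinuousOn (fun t => ∫ x, g t x) (Ici 0) := by
  intro t ht
  rw [mem_Ici] at ht
  obtain ⟨C, hC⟩ := hg.2 (t + 1) (by linarith)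
  refine continuousWithinAt_of_dominated (bound := fun x => C * (1 + ‖x‖) ^ (-4 : ℝ)) ?_ ?_
    (integrable_decayWeight.const_mul C) (.of_forall fun x => hg.continuousOn_apply x t ht)
  · filter_upwards [self_mem_nhdsWithin] with s hs
    exact (hg.isDecaying hs).1.aestronglyMeasurable
  · filter_upwards [self_mem_nhdsWithin, nhdsWithin_le_nhds (Iic_mem_nhds (lt_add_one t))]
      with s hs hs'
    exact .of_forall fun x => hC s ⟨hs, hs'⟩ x

end LocDecaying

namespace SchwartzLocBdd

variable {F G : Type*} [NormedAddCommGroup F] [NormedSpace ℝ F] [NormedAddCommGroup G]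
  [NormedSpace ℝ G]

lemma contDiff {g : ℝ → V3 → F} (hg : SchwartzLocBdd g) {t : ℝ} (ht : 0 ≤ t) :
    ContDiff ℝ (⊤ : ℕ∞) (g t) := by
  rw [← contDiffOn_univ]
  exact hg.1.comp (f := fun x => (t, x)) (by fun_prop) fun x _ => ⟨ht, mem_univ x⟩

lemma clm_comp {g : ℝ → V3 → F} (hg : SchwartzLocBdd g) (L : F →L[ℝ] G) :
    SchwartzLocBdd (fun t x => L (g t x)) := by
  refine ⟨L.contDiff.comp_contDiffOn hg.1, fun T hT k n => ?_⟩
  obtain ⟨C, hC⟩ := hg.2 T hT k n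
  refine ⟨‖L‖ * C, fun t ht x => ?_⟩
  have h := L.norm_iteratedFDeriv_comp_left (hg.contDiff ht.1).contDiffAt (x := x) (n := n)
    (by exact_mod_cast le_top)
  calc ‖x‖ ^ k * ‖iteratedFDeriv ℝ n (fun x => L (g t x)) x‖
      ≤ ‖x‖ ^ k * (‖L‖ * ‖iteratedFDeriv ℝ n (g t) x‖) := by gcongr; exact h
    _ = ‖L‖ * (‖x‖ ^ k * ‖iteratedFDeriv ℝ n (g t) x‖) := by ring
    _ ≤ ‖L‖ * C := by gcongr; exact hC t ht x

lemma add {g h : ℝ → V3 → F} (hg : SchwartzLocBdd g) (hh : SchwartzLocBdd h) :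
    SchwartzLocBdd (fun t x => g t x + h t x) := by
  refine ⟨hg.1.add hh.1, fun T hT k n => ?_⟩
  obtain ⟨C, hC⟩ := hg.2 T hT k n
  obtain ⟨D, hD⟩ := hh.2 T hT k n
  refine ⟨C + D, fun t ht x => ?_⟩
  have hn : (n : WithTop ℕ∞) ≤ (⊤ : ℕ∞) := by exact_mod_cast le_top
  have hadd := iteratedFDeriv_add_apply (𝕜 := ℝ) (i := n) (x := x)
    ((hg.contDiff ht.1).contDiffAt.of_le hn) ((hh.contDiff ht.1).contDiffAt.of_le hn)
  change ‖x‖ ^ k * ‖iteratedFDeriv ℝ n (g t + h t) x‖ ≤ _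
  rw [hadd]
  calc _ ≤ ‖x‖ ^ k * (‖iteratedFDeriv ℝ n (g t) x‖ + ‖iteratedFDeriv ℝ n (h t) x‖) := by
        gcongr; exact norm_add_le _ _
    _ ≤ C + D := by linarith [hC t ht x, hD t ht x]

lemma sub {g h : ℝ → V3 → F} (hg : SchwartzLocBdd g) (hh : SchwartzLocBdd h) :
    SchwartzLocBdd (fun t x => g t x - h t x) := by
  simpa [← sub_eq_add_neg] using hg.add (hh.clm_comp (-ContinuousLinearMap.id ℝ F))

lemma apply {g : ℝ → V3 → Fin 3 → ℝ} (hg : SchwartzLocBdd g) (i : Fin 3) :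
    SchwartzLocBdd (fun t x => g t x i) :=
  hg.clm_comp (ContinuousLinearMap.proj (R := ℝ) (φ := fun _ : Fin 3 => ℝ) i)

variable {g : ℝ → V3 → ℝ}

lemma const_mul (a : ℝ) (hg : SchwartzLocBdd g) : SchwartzLocBdd (fun t x => a * g t x) :=
  hg.clm_comp (a • ContinuousLinearMap.id ℝ ℝ)

lemma pdS_eq_fderivWithin (hg : SchwartzLocBdd g) (j : Fin 3) {q : ℝ × V3}
    (hq : q ∈ Ici (0 : ℝ) ×ˢ univ) :
    pdS j (g q.1) q.2 = fderivWithin ℝ (fun q : ℝ × V3 => g q.1 q.2) (Ici (0 : ℝ) ×ˢ univ) q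
      ((0 : ℝ), (Pi.single j 1 : V3)) := by
  have h1 := (hg.1.differentiableOn (by simp) q hq).hasFDerivWithinAt
  have h2 : HasFDerivAt (fun x : V3 => (q.1, x)) (ContinuousLinearMap.inr ℝ ℝ V3) q.2 :=
    hasFDerivAt_prodMk_right q.1 q.2
  have h3 := HasFDerivWithinAt.comp_hasFDerivAt q.2 (f := fun x : V3 => (q.1, x)) h1 h2
    (.of_forall fun x => ⟨hq.1, mem_univ x⟩)
  have h4 : fderiv ℝ (g q.1) q.2 = _ := h3.fderiv
  simp [pdS, h4]

lemma partialDeriv (hg : SchwartzLocBdd g) (j : Fin 3) : SchwartzLocBdd (fun t => pdS j (g t)) := by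
  have hu : UniqueDiffOn ℝ (Ici (0 : ℝ) ×ˢ (univ : Set V3)) :=
    (uniqueDiffOn_Ici 0).prod uniqueDiffOn_univ
  refine ⟨?_, fun T hT k n => ?_⟩
  · refine ContDiffOn.congr ?_ fun q hq => hg.pdS_eq_fderivWithin j hq
    exact (hg.1.fderivWithin hu (by simp)).clm_apply contDiffOn_const
  · obtain ⟨C, hC⟩ := hg.2 T hT k (n + 1)
    refine ⟨‖(Pi.single j 1 : V3)‖ * C, fun t ht x => ?_⟩
    have h := norm_iteratedFDeriv_clm_apply_const (𝕜 := ℝ) (c := (Pi.single j 1 : V3)) (x := x)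
      (n := n) (N := (⊤ : ℕ∞))
      ((hg.contDiff ht.1).fderiv_right (m := (⊤ : ℕ∞)) (by simp)).contDiffAt
      (by exact_mod_cast le_top)
    rw [norm_iteratedFDeriv_fderiv] at h
    calc _ ≤ ‖x‖ ^ k * (‖(Pi.single j 1 : V3)‖ * ‖iteratedFDeriv ℝ (n + 1) (g t) x‖) := by
          gcongr; exact h
      _ = ‖(Pi.single j 1 : V3)‖ * (‖x‖ ^ k * ‖iteratedFDeriv ℝ (n + 1) (g t) x‖) := by ring
      _ ≤ _ := by gcongr; exact hC t ht x

lemma locDecaying (hg : SchwartzLocBdd g) : LocDecaying g := by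
  refine ⟨hg.1.continuousOn, fun T hT => ?_⟩
  obtain ⟨C, hC⟩ := hg.2 T hT 0 0
  obtain ⟨D, hD⟩ := hg.2 T hT 4 0
  refine ⟨8 * (C + D), fun t ht x => ?_⟩
  have h1 := hC t ht x
  have h2 := hD t ht x
  rw [norm_iteratedFDeriv_zero, Real.norm_eq_abs] at h1 h2
  have h3 : (1 + ‖x‖) ^ 4 ≤ 8 * (1 + ‖x‖ ^ 4) := by
    have := add_pow_le zero_le_one (norm_nonneg x) 4
    norm_num at this
    linarith
  have h4 : (1 + ‖x‖) ^ (-4 : ℝ) = ((1 + ‖x‖) ^ 4)⁻¹ := by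
    rw [Real.rpow_neg (by positivity)]; norm_cast
  rw [h4, ← div_eq_mul_inv, le_div_iff₀ (by positivity)]
  calc |g t x| * (1 + ‖x‖) ^ 4 ≤ |g t x| * (8 * (1 + ‖x‖ ^ 4)) := by gcongr
    _ ≤ _ := by linarith

lemma isDecaying (hg : SchwartzLocBdd g) {t : ℝ} (ht : 0 ≤ t) : IsDecaying (g t) :=
  hg.locDecaying.isDecaying ht

lemma isDecayingC1 (hg : SchwartzLocBdd g) {t : ℝ} (ht : 0 ≤ t) : IsDecayingC1 (g t) :=
  ⟨(hg.contDiff ht).of_le (by exact_mod_cast le_top), hg.isDecaying ht,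
    fun j => (hg.partialDeriv j).isDecaying ht⟩

end SchwartzLocBdd

/-- The scalar Laplacian on `V3`. -/
def lap (g : V3 → ℝ) : V3 → ℝ := fun x => ∑ j, pdS j (pdS j g) x

lemma SchwartzLocBdd.lap {g : ℝ → V3 → ℝ} (hg : SchwartzLocBdd g) :
    SchwartzLocBdd (fun t => lap (g t)) := by
  have h := fun j => (hg.partialDeriv j).partialDeriv j
  change SchwartzLocBdd fun t x => ∑ j, pdS j (pdS j (g t)) x
  simpa only [Fin.sum_univ_three] using ((h 0).add (h 1)).add (h 2)

lemma SchwartzLocBdd.isSchwartz {F : Type*} [NormedAddCommGroup F] [NormedSpace ℝ F]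
    {g : ℝ → V3 → F} (hg : SchwartzLocBdd g) {t : ℝ} (ht : 0 ≤ t) : IsSchwartz (g t) := by
  refine ⟨hg.contDiff ht, fun k n => ?_⟩
  obtain ⟨C, hC⟩ := hg.2 (t + 1) (by linarith) k n
  exact ⟨C, hC t ⟨ht, by linarith⟩⟩

namespace IsSchwartz

lemma schwartzLocBdd {F : Type*} [NormedAddCommGroup F] [NormedSpace ℝ F] {g : V3 → F}
    (hg : IsSchwartz g) : SchwartzLocBdd (fun _ => g) := by
  refine ⟨(hg.1.comp contDiff_snd).contDiffOn, fun T _ k n => ?_⟩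
  obtain ⟨C, hC⟩ := hg.2 k n
  exact ⟨C, fun _ _ => hC⟩

variable {f g h : V3 → ℝ}

lemma isDecayingC1 (hg : IsSchwartz g) : IsDecayingC1 g := hg.schwartzLocBdd.isDecayingC1 le_rfl

lemma isDecaying (hg : IsSchwartz g) : IsDecaying g := hg.isDecayingC1.2.1

lemma differentiable (hg : IsSchwartz g) : Differentiable ℝ g := hg.1.differentiable (by simp)

lemma partialDeriv (hg : IsSchwartz g) (j : Fin 3) : IsSchwartz (pdS j g) :=
  (hg.schwartzLocBdd.partialDeriv j).isSchwartz le_rfl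

lemma lap (hg : IsSchwartz g) : IsSchwartz (lap g) := hg.schwartzLocBdd.lap.isSchwartz le_rfl

lemma sub (hg : IsSchwartz g) (hh : IsSchwartz h) : IsSchwartz (fun x => g x - h x) :=
  (hg.schwartzLocBdd.sub hh.schwartzLocBdd).isSchwartz le_rfl

lemma pdS_sub (hg : IsSchwartz g) (hh : IsSchwartz h) (j : Fin 3) (x : V3) :
    pdS j (fun x => g x - h x) x = pdS j g x - pdS j h x := by
  have := ((hg.differentiable x).hasFDerivAt.fun_sub (hh.differentiable x).hasFDerivAt).fderiv
  simp [pdS, this]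

lemma lap_sub (hg : IsSchwartz g) (hh : IsSchwartz h) (x : V3) :
    _root_.lap (fun x => g x - h x) x = _root_.lap g x - _root_.lap h x := by
  simp only [_root_.lap, funext (hg.pdS_sub hh _),
    (hg.partialDeriv _).pdS_sub (hh.partialDeriv _), Finset.sum_sub_distrib]

lemma integral_mul_lap (hg : IsSchwartz g) (hh : IsSchwartz h) :
    ∫ x, g x * _root_.lap h x = -∑ j, ∫ x, pdS j g x * pdS j h x := by
  simp only [_root_.lap, Finset.mul_sum]
  rw [integral_finsetSum _ fun j _ =>
    (hg.isDecaying.mul ((hh.partialDeriv j).partialDeriv j).isDecaying).integrable,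
    ← Finset.sum_neg_distrib]
  exact Finset.sum_congr rfl fun j _ =>
    hg.isDecayingC1.integral_mul_pdS (hh.partialDeriv j).isDecayingC1 j

lemma integral_mul_lap_comm (hg : IsSchwartz g) (hh : IsSchwartz h) :
    ∫ x, g x * _root_.lap h x = ∫ x, h x * _root_.lap g x := by
  simp only [hg.integral_mul_lap hh, hh.integral_mul_lap hg, mul_comm]

/-- The operator `1 - α²Δ` is symmetric. -/
lemma integral_mul_helmholtz_comm (hg : IsSchwartz g) (hh : IsSchwartz h) (α : ℝ) :
    ∫ x, g x * (h x - α ^ 2 * _root_.lap h x) = ∫ x, h x * (g x - α ^ 2 * _root_.lap g x) := by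
  have key : ∀ {g h : V3 → ℝ}, IsSchwartz g → IsSchwartz h →
      ∫ x, g x * (h x - α ^ 2 * _root_.lap h x)
        = (∫ x, g x * h x) - α ^ 2 * ∫ x, g x * _root_.lap h x := by
    intro g h hg hh
    rw [← integral_const_mul, ← integral_sub (hg.isDecaying.mul hh.isDecaying).integrable
      ((hg.isDecaying.mul hh.lap.isDecaying).const_mul _).integrable]
    congr 1 with x
    ring
  rw [key hg hh, key hh hg, hg.integral_mul_lap_comm hh]
  simp only [mul_comm (g _) (h _)]

lemma integral_mul_helmholtz_self (hg : IsSchwartz g) (α : ℝ) :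
    ∫ x, g x * (g x - α ^ 2 * _root_.lap g x)
      = (∫ x, g x ^ 2) + α ^ 2 * ∑ j, ∫ x, pdS j g x ^ 2 := by
  have h := hg.integral_mul_lap hg
  have e : ∫ x, g x * (g x - α ^ 2 * _root_.lap g x)
      = (∫ x, g x ^ 2) - α ^ 2 * ∫ x, g x * _root_.lap g x := by
    rw [← integral_const_mul, ← integral_sub hg.isDecaying.sq.integrable
      ((hg.isDecaying.mul hg.lap.isDecaying).const_mul _).integrable]
    congr 1 with x
    ring
  rw [e, h]
  simp only [← sq]
  ring

lemma pdS_comm (hg : IsSchwartz g) (i j : Fin 3) : pdS i (pdS j g) = pdS j (pdS i g) := by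
  have key : ∀ i j x, pdS i (pdS j g) x
      = fderiv ℝ (fderiv ℝ g) x (Pi.single i 1) (Pi.single j 1) := by
    intro i j x
    have hd : DifferentiableAt ℝ (fderiv ℝ g) x :=
      (hg.1.fderiv_right (m := (⊤ : ℕ∞)) (by simp)).differentiable (by simp) x
    have := (hd.hasFDerivAt.clm_apply (hasFDerivAt_const (Pi.single j 1 : V3) x)).fderiv
    change fderiv ℝ (fun y => fderiv ℝ g y (Pi.single j 1)) x (Pi.single i 1) = _
    rw [this]
    simp
  ext x
  rw [key, key]
  exact (hg.1.contDiffAt.isSymmSndFDerivAt (by simp; exact WithTop.coe_le_coe.2 le_top)) _ _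

lemma lap_pdS (hg : IsSchwartz g) (i : Fin 3) : _root_.lap (pdS i g) = pdS i (_root_.lap g) := by
  ext x
  have h : pdS i (_root_.lap g) x = ∑ j, pdS i (pdS j (pdS j g)) x := by
    have := (HasFDerivAt.fun_sum (u := Finset.univ) (x := x) fun j _ =>
      (((hg.partialDeriv j).partialDeriv j).differentiable x).hasFDerivAt).fderiv
    change fderiv ℝ (fun y => ∑ j, pdS j (pdS j g) y) x (Pi.single i 1) = _
    rw [this]
    simp [pdS]
  rw [h]
  refine Finset.sum_congr rfl fun j _ => ?_
  rw [hg.pdS_comm j i, (hg.partialDeriv j).pdS_comm j i]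

lemma integral_lap_mul_helmholtz_le (hg : IsSchwartz g) (α : ℝ) :
    ∫ x, _root_.lap g x * (g x - α ^ 2 * _root_.lap g x) ≤ -∑ j, ∫ x, pdS j g x ^ 2 := by
  have h := hg.integral_mul_lap hg
  have e : ∫ x, _root_.lap g x * (g x - α ^ 2 * _root_.lap g x)
      = (∫ x, g x * _root_.lap g x) - α ^ 2 * ∫ x, _root_.lap g x ^ 2 := by
    rw [← integral_const_mul, ← integral_sub (hg.isDecaying.mul hg.lap.isDecaying).integrable
      (hg.lap.isDecaying.sq.const_mul _).integrable]
    congr 1 with x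
    ring
  have := mul_nonneg (sq_nonneg α)
    (integral_nonneg fun x => sq_nonneg (_root_.lap g x) : 0 ≤ ∫ x, _root_.lap g x ^ 2)
  simp only [← sq] at h
  rw [e, h]
  linarith

end IsSchwartz

lemma SchwartzLocBdd.helmholtz {g : ℝ → V3 → ℝ} (hg : SchwartzLocBdd g) (α : ℝ) :
    SchwartzLocBdd (fun t x => g t x - α ^ 2 * _root_.lap (g t) x) :=
  hg.sub (hg.lap.const_mul _)

/-- The time derivative of the `H¹_α` energy. Only the time derivative of `g` itself enters, by
symmetry of `1 - α²Δ`. -/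
lemma SchwartzLocBdd.hasDerivAt_energy {g R : ℝ → V3 → ℝ} (hg : SchwartzLocBdd g)
    (hR : LocDecaying R) (hgR : ∀ t > 0, ∀ x, HasDerivAt (fun s => g s x) (R t x) t) (α : ℝ)
    {t : ℝ} (ht : 0 < t) :
    HasDerivAt (fun s => ∫ x, g s x * (g s x - α ^ 2 * _root_.lap (g s) x))
      (2 * ∫ x, R t x * (g t x - α ^ 2 * _root_.lap (g t) x)) t := by
  have hA := (hg.helmholtz α).locDecaying
  have hsymm : ∀ s > 0, ∫ x, g s x * (g t x - α ^ 2 * _root_.lap (g t) x)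
      = ∫ x, g t x * (g s x - α ^ 2 * _root_.lap (g s) x) := fun s hs =>
    (hg.isSchwartz hs.le).integral_mul_helmholtz_comm (hg.isSchwartz ht.le) α
  set A : ℝ → V3 → ℝ := fun t x => g t x - α ^ 2 * _root_.lap (g t) x with hAdef
  have hgd := hg.locDecaying
  rw [hasDerivAt_iff_tendsto_slope]
  have hpos : ∀ᶠ s in nhdsWithin t {t}ᶜ, 0 < s := nhdsWithin_le_nhds (Ioi_mem_nhds ht)
  have hlt : ∀ᶠ s in nhdsWithin t {t}ᶜ, s < t + 1 :=
    nhdsWithin_le_nhds (Iio_mem_nhds (lt_add_one t))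
  have hslope : (fun s => ∫ x, slope (fun s => g s x) t s * (A s x + A t x))
      =ᶠ[nhdsWithin t {t}ᶜ] slope (fun s => ∫ x, g s x * A s x) t := by
    filter_upwards [hpos] with s hs
    have i1 := fun {a b : ℝ} (ha : 0 < a) (hb : 0 < b) =>
      ((hgd.isDecaying ha.le).mul (hA.isDecaying hb.le)).integrable
    simp only [slope_def_field]
    calc ∫ x, (g s x - g t x) / (s - t) * (A s x + A t x)
        = ∫ x, (s - t)⁻¹ * ((g s x * A s x - g t x * A t x)
            + (g s x * A t x - g t x * A s x)) := by
          congr 1 with x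
          ring
      _ = _ := by
          have h1 := integral_sub (i1 hs hs) (i1 ht ht)
          have h2 := integral_sub (i1 hs ht) (i1 ht hs)
          have h3 := integral_add ((i1 hs hs).sub (i1 ht ht)) ((i1 hs ht).sub (i1 ht hs))
          simp only [Pi.sub_apply] at h3
          rw [integral_const_mul, h3, h1, h2, hsymm s hs]
          ring
  refine Filter.Tendsto.congr' hslope ?_
  obtain ⟨C, hC⟩ := hA.2 (t + 1) (by linarith)
  obtain ⟨D, hD⟩ := hR.2 (t + 1) (by linarith)
  have hlim : 2 * ∫ x, R t x * A t x = ∫ x, R t x * (A t x + A t x) := by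
    rw [← integral_const_mul]
    congr 1 with x
    ring
  rw [hlim]
  refine tendsto_integral_filter_of_dominated_convergence
    (fun x => D * (C + C) * (1 + ‖x‖) ^ (-4 : ℝ)) ?_ ?_ (integrable_decayWeight.const_mul _) ?_
  · filter_upwards [hpos] with s hs
    simp only [slope_def_field]
    refine Continuous.aestronglyMeasurable ?_
    exact (((hgd.isDecaying hs.le).1.sub (hgd.isDecaying ht.le).1).div_const _).mul
      ((hA.isDecaying hs.le).1.add (hA.isDecaying ht.le).1)
  · filter_upwards [hpos, hlt, self_mem_nhdsWithin] with s hs hs1 hst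
    refine .of_forall fun x => abs_mul_le_decayWeight ?_ ?_
    · have hmv := (convex_Ioo 0 (t + 1)).norm_image_sub_le_of_norm_hasDerivWithin_le
        (f := fun s => g s x) (f' := fun s => R s x) (C := D * (1 + ‖x‖) ^ (-4 : ℝ))
        (fun r hr => (hgR r hr.1 x).hasDerivWithinAt)
        (fun r hr => hD r ⟨hr.1.le, hr.2.le⟩ x) (⟨ht, lt_add_one t⟩ : t ∈ Ioo 0 (t + 1))
        (⟨hs, hs1⟩ : s ∈ Ioo 0 (t + 1))
      have hst' : 0 < |s - t| := abs_pos.2 (sub_ne_zero.2 hst)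
      rw [slope_def_field, abs_div, div_le_iff₀ hst']
      exact hmv
    · linarith [abs_add_le (A s x) (A t x), hC s ⟨hs.le, hs1.le⟩ x,
        hC t ⟨ht.le, (lt_add_one t).le⟩ x]
  · refine .of_forall fun x => ?_
    have h1 : Filter.Tendsto (fun s => A s x) (nhdsWithin t {t}ᶜ) (nhds (A t x)) :=
      ((hA.continuousOn_apply x).continuousAt (Ici_mem_nhds ht)).tendsto.mono_left
        nhdsWithin_le_nhds
    exact (hasDerivAt_iff_tendsto_slope.1 (hgR t ht x)).mul (h1.add_const _)

section Energy

variable {u v w M : Fin 3 → V3 → ℝ} {q g : V3 → ℝ}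

/-- Divergence-free fields are orthogonal to gradients. -/
lemma sum_integral_mul_pdS_eq_zero (hw : ∀ i, IsSchwartz (w i)) (hq : IsDecayingC1 q)
    (hdiv : ∀ x, ∑ i, pdS i (w i) x = 0) : ∑ i, ∫ x, w i x * pdS i q x = 0 := by
  simp only [fun i => (hw i).isDecayingC1.integral_mul_pdS hq i, Finset.sum_neg_distrib]
  rw [← integral_finsetSum _ fun i _ =>
    (((hw i).partialDeriv i).isDecaying.mul hq.2.1).integrable]
  simp only [← Finset.sum_mul, hdiv, zero_mul, integral_zero, neg_zero]

lemma sum_integral_mul_helmholtz_pdS_eq_zero (hw : ∀ i, IsSchwartz (w i)) (hq : IsSchwartz q)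
    (hdiv : ∀ x, ∑ i, pdS i (w i) x = 0) (α : ℝ) :
    ∑ i, ∫ x, pdS i q x * (w i x - α ^ 2 * lap (w i) x) = 0 := by
  have h : ∀ i, ∫ x, pdS i q x * (w i x - α ^ 2 * lap (w i) x)
      = (∫ x, w i x * pdS i q x) - α ^ 2 * ∫ x, w i x * pdS i (lap q) x := by
    intro i
    rw [(hq.partialDeriv i).integral_mul_helmholtz_comm (hw i), hq.lap_pdS, ← integral_const_mul,
      ← integral_sub ((hw i).isDecaying.mul (hq.partialDeriv i).isDecaying).integrable
      (((hw i).isDecaying.mul (hq.lap.partialDeriv i).isDecaying).const_mul _).integrable]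
    congr 1 with x
    ring
  simp only [h, Finset.sum_sub_distrib, ← Finset.mul_sum,
    sum_integral_mul_pdS_eq_zero hw hq.isDecayingC1 hdiv,
    sum_integral_mul_pdS_eq_zero hw hq.lap.isDecayingC1 hdiv, mul_zero, sub_zero]

/-- The transport term of a divergence-free field is skew-symmetric. -/
lemma sum_integral_mul_transport_eq_zero (hv : ∀ i, IsSchwartz (v i)) (hg : IsSchwartz g)
    (hdiv : ∀ x, ∑ i, pdS i (v i) x = 0) : ∑ j, ∫ x, g x * (v j x * pdS j g x) = 0 := by
  have h := sum_integral_mul_pdS_eq_zero hv (hg.isDecayingC1.pow_succ 0) hdiv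
  have e : ∀ j x, pdS j (fun x => g x ^ (0 + 2)) x = 2 * g x * pdS j g x := by
    intro j x
    have := ((hg.differentiable x).hasFDerivAt.pow 2).fderiv
    change fderiv ℝ (fun x => g x ^ 2) x _ = _
    rw [this]
    simp [pdS]
  have e2 : ∀ j, ∫ x, v j x * pdS j (fun x => g x ^ (0 + 2)) x
      = 2 * ∫ x, g x * (v j x * pdS j g x) := by
    intro j
    rw [← integral_const_mul]
    congr 1 with x
    rw [e]
    ring
  simp only [e2, ← Finset.mul_sum] at h
  linarith

lemma abs_sum_integral_stretching_le (hw : ∀ i, IsSchwartz (w i)) (hu : ∀ i, IsSchwartz (u i)) :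
    |∑ i, ∑ j, ∫ x, w i x * w j x * pdS j (u i) x|
      ≤ 9 * √(333 * ((∑ i, ∫ x, w i x ^ 2) * (∑ i, ∑ j, ∫ x, pdS j (w i) x ^ 2)
        * (√(∑ i, ∑ j, ∫ x, pdS j (u i) x ^ 2)
          * √(∑ i, ∑ j, ∑ k, ∫ x, pdS k (pdS j (u i)) x ^ 2)))) := by
  have nn : ∀ f : V3 → ℝ, 0 ≤ ∫ x, f x ^ 2 := fun f => integral_nonneg fun x => sq_nonneg _
  set X := ∑ i, ∫ x, w i x ^ 2
  set Y := ∑ i, ∑ j, ∫ x, pdS j (w i) x ^ 2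
  set H₁ := ∑ i, ∑ j, ∫ x, pdS j (u i) x ^ 2
  set H₂ := ∑ i, ∑ j, ∑ k, ∫ x, pdS k (pdS j (u i)) x ^ 2
  have hX0 : 0 ≤ X := Finset.sum_nonneg fun i _ => nn _
  have hY0 : 0 ≤ Y := Finset.sum_nonneg fun i _ => Finset.sum_nonneg fun j _ => nn _
  have hH₁0 : 0 ≤ H₁ := Finset.sum_nonneg fun i _ => Finset.sum_nonneg fun j _ => nn _
  have hH₂0 : 0 ≤ H₂ := Finset.sum_nonneg fun i _ => Finset.sum_nonneg fun j _ =>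
    Finset.sum_nonneg fun k _ => nn _
  have hterm : ∀ i j, |∫ x, w i x * w j x * pdS j (u i) x|
      ≤ √(333 * (X * Y * (√H₁ * √H₂))) := by
    intro i j
    have h := pow_four_integral_mul_mul_le (hw i).isDecaying (hw j).isDecayingC1
      ((hu i).partialDeriv j).isDecayingC1
    have h1 : ∫ x, w i x ^ 2 ≤ X :=
      Finset.single_le_sum (f := fun i => ∫ x, w i x ^ 2) (fun i _ => nn _) (Finset.mem_univ i)
    have h2 : ∑ k, ∫ x, pdS k (w j) x ^ 2 ≤ Y :=
      Finset.single_le_sum (f := fun i => ∑ j, ∫ x, pdS j (w i) x ^ 2)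
        (fun i _ => Finset.sum_nonneg fun j _ => nn _) (Finset.mem_univ j)
    have h3 : ∫ x, pdS j (u i) x ^ 2 ≤ H₁ :=
      (Finset.single_le_sum (f := fun j => ∫ x, pdS j (u i) x ^ 2)
        (fun j _ => nn _) (Finset.mem_univ j)).trans
      (Finset.single_le_sum (f := fun i => ∑ j, ∫ x, pdS j (u i) x ^ 2)
        (fun i _ => Finset.sum_nonneg fun j _ => nn _) (Finset.mem_univ i))
    have h4 : ∑ k, ∫ x, pdS k (pdS j (u i)) x ^ 2 ≤ H₂ :=
      (Finset.single_le_sum (f := fun j => ∑ k, ∫ x, pdS k (pdS j (u i)) x ^ 2)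
        (fun j _ => Finset.sum_nonneg fun k _ => nn _) (Finset.mem_univ j)).trans
      (Finset.single_le_sum (f := fun i => ∑ j, ∑ k, ∫ x, pdS k (pdS j (u i)) x ^ 2)
        (fun i _ => Finset.sum_nonneg fun j _ => Finset.sum_nonneg fun k _ => nn _)
        (Finset.mem_univ i))
    have h5 : (∫ x, w i x * w j x * pdS j (u i) x) ^ 4
        ≤ X ^ 2 * (48 ^ 3 * H₁ * (Y ^ 2 * H₂)) := by
      refine h.trans ?_
      have := Finset.sum_nonneg fun (k : Fin 3) (_ : k ∈ Finset.univ) => nn (pdS k (w j))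
      have := Finset.sum_nonneg fun (k : Fin 3) (_ : k ∈ Finset.univ) => nn (pdS k (pdS j (u i)))
      have := nn (w i)
      have := nn (pdS j (u i))
      gcongr
    clear_value X Y H₁ H₂
    refine Real.le_sqrt_of_sq_le ?_
    rw [sq_abs]
    generalize ∫ x, w i x * w j x * pdS j (u i) x = I at h5 ⊢
    refine le_of_abs_le (abs_le_of_sq_le_sq ?_ (by positivity))
    calc (I ^ 2) ^ 2 = I ^ 4 := by ring
      _ ≤ 48 ^ 3 * (X ^ 2 * Y ^ 2 * (H₁ * H₂)) := by linarith
      _ ≤ 333 ^ 2 * (X ^ 2 * Y ^ 2 * (H₁ * H₂)) := by gcongr; norm_num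
      _ = 333 ^ 2 * (X ^ 2 * Y ^ 2 * (√H₁ ^ 2 * √H₂ ^ 2)) := by
        rw [Real.sq_sqrt hH₁0, Real.sq_sqrt hH₂0]
      _ = _ := by ring
  generalize √(333 * (X * Y * (√H₁ * √H₂))) = B at hterm ⊢
  have hsum : ∀ {f : Fin 3 → ℝ} {C : ℝ}, (∀ i, |f i| ≤ C) → |∑ i, f i| ≤ 3 * C := by
    intro f C hf
    simpa using (Finset.abs_sum_le_sum_abs f Finset.univ).trans
      (Finset.sum_le_sum fun i _ => hf i)
  linarith [hsum fun i => hsum (hterm i)]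

/-- The difference of the filtered nonlinearities, tested against the difference of the
velocities, leaves only the stretching term. -/
lemma sum_integral_mul_helmholtz_nonlinearity (hu : ∀ i, IsSchwartz (u i))
    (hv : ∀ i, IsSchwartz (v i)) (hM : ∀ i, IsSchwartz (M i)) {α : ℝ}
    (hdiv : ∀ x, ∑ i, pdS i (v i) x = 0)
    (hfilter : ∀ i x, M i x - α ^ 2 * lap (M i) x
      = (∑ j, u j x * pdS j (u i) x) - ∑ j, v j x * pdS j (v i) x)
    (hw : ∀ i, w i = fun x => u i x - v i x) :
    ∑ i, ∫ x, M i x * (w i x - α ^ 2 * lap (w i) x)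
      = ∑ i, ∑ j, ∫ x, w i x * w j x * pdS j (u i) x := by
  have hwS : ∀ i, IsSchwartz (w i) := fun i => by rw [hw]; exact (hu i).sub (hv i)
  refine Finset.sum_congr rfl fun i _ => ?_
  have i1 : ∀ j, Integrable fun x => w i x * w j x * pdS j (u i) x := fun j =>
    (((hwS i).isDecaying.mul (hwS j).isDecaying).mul ((hu i).partialDeriv j).isDecaying).integrable
  have i2 : ∀ j, Integrable fun x => w i x * (v j x * pdS j (w i) x) := fun j =>
    ((hwS i).isDecaying.mul ((hv j).isDecaying.mul ((hwS i).partialDeriv j).isDecaying)).integrable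
  rw [(hM i).integral_mul_helmholtz_comm (hwS i)]
  calc ∫ x, w i x * (M i x - α ^ 2 * lap (M i) x)
      = ∫ x, ∑ j, (w i x * w j x * pdS j (u i) x + w i x * (v j x * pdS j (w i) x)) := by
        congr 1 with x
        rw [hfilter, ← Finset.sum_sub_distrib, Finset.mul_sum]
        refine Finset.sum_congr rfl fun j _ => ?_
        rw [hw i, (hu i).pdS_sub (hv i), hw j]
        ring
    _ = ∑ j, ((∫ x, w i x * w j x * pdS j (u i) x) + ∫ x, w i x * (v j x * pdS j (w i) x)) := by
        refine (integral_finsetSum _ fun j _ => (i1 j).add (i2 j)).trans ?_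
        exact Finset.sum_congr rfl fun j _ => integral_add (i1 j) (i2 j)
    _ = _ := by
        rw [Finset.sum_add_distrib, sum_integral_mul_transport_eq_zero hv (hwS i) hdiv, add_zero]

/-- The energy inequality for the difference of two solutions at a fixed time. -/
lemma two_mul_sum_integral_mul_helmholtz_le (hu : ∀ i, IsSchwartz (u i))
    (hv : ∀ i, IsSchwartz (v i)) (hM : ∀ i, IsSchwartz (M i)) (hq : IsSchwartz q) {α β ν : ℝ}
    (hβ : 0 < β) (hν : 0 < ν) (hdivu : ∀ x, ∑ i, pdS i (u i) x = 0)
    (hdiv : ∀ x, ∑ i, pdS i (v i) x = 0)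
    (hfilter : ∀ i x, M i x - α ^ 2 * lap (M i) x
      = (∑ j, u j x * pdS j (u i) x) - ∑ j, v j x * pdS j (v i) x)
    (hw : ∀ i, w i = fun x => u i x - v i x) :
    2 * ∑ i, ∫ x, (ν * lap (w i) x - M i x - pdS i q x - β * w i x)
        * (w i x - α ^ 2 * lap (w i) x)
      ≤ 14000 / ν * (√(∑ i, ∑ j, ∫ x, pdS j (u i) x ^ 2)
          * √(∑ i, ∑ j, ∑ k, ∫ x, pdS k (pdS j (u i)) x ^ 2))
        * ∑ i, ∫ x, w i x * (w i x - α ^ 2 * lap (w i) x) := by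
  have hwS : ∀ i, IsSchwartz (w i) := fun i => by rw [hw]; exact (hu i).sub (hv i)
  have hdivw : ∀ x, ∑ i, pdS i (w i) x = 0 := by
    intro x
    simp only [hw, (hu _).pdS_sub (hv _), Finset.sum_sub_distrib, hdivu, hdiv, sub_zero]
  have nn : ∀ f : V3 → ℝ, 0 ≤ ∫ x, f x ^ 2 := fun f => integral_nonneg fun x => sq_nonneg _
  have hT := abs_sum_integral_stretching_le hwS hu
  rw [← sum_integral_mul_helmholtz_nonlinearity hu hv hM hdiv hfilter hw] at hT
  have hp := sum_integral_mul_helmholtz_pdS_eq_zero hwS hq hdivw α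
  have hl : ∑ i, ∫ x, lap (w i) x * (w i x - α ^ 2 * lap (w i) x)
      ≤ -∑ i, ∑ j, ∫ x, pdS j (w i) x ^ 2 := by
    rw [← Finset.sum_neg_distrib]
    exact Finset.sum_le_sum fun i _ => (hwS i).integral_lap_mul_helmholtz_le α
  have hE : ∑ i, ∫ x, w i x * (w i x - α ^ 2 * lap (w i) x)
      = (∑ i, ∫ x, w i x ^ 2) + α ^ 2 * ∑ i, ∑ j, ∫ x, pdS j (w i) x ^ 2 := by
    rw [Finset.mul_sum, ← Finset.sum_add_distrib]
    exact Finset.sum_congr rfl fun i _ => (hwS i).integral_mul_helmholtz_self α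
  have hsplit : ∑ i, ∫ x, (ν * lap (w i) x - M i x - pdS i q x - β * w i x)
        * (w i x - α ^ 2 * lap (w i) x)
      = ν * (∑ i, ∫ x, lap (w i) x * (w i x - α ^ 2 * lap (w i) x))
        - (∑ i, ∫ x, M i x * (w i x - α ^ 2 * lap (w i) x))
        - (∑ i, ∫ x, pdS i q x * (w i x - α ^ 2 * lap (w i) x))
        - β * ∑ i, ∫ x, w i x * (w i x - α ^ 2 * lap (w i) x) := by
    simp only [Finset.mul_sum, ← Finset.sum_sub_distrib]
    refine Finset.sum_congr rfl fun i _ => ?_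
    have hA : IsDecaying fun x => w i x - α ^ 2 * lap (w i) x :=
      ((hwS i).schwartzLocBdd.helmholtz α).isDecaying le_rfl
    have i1 := (((hwS i).lap.isDecaying.mul hA).const_mul ν).integrable
    have i2 := ((hM i).isDecaying.mul hA).integrable
    have i3 := ((hq.partialDeriv i).isDecaying.mul hA).integrable
    have i4 := (((hwS i).isDecaying.mul hA).const_mul β).integrable
    have h1 := integral_sub i1 i2
    have h2 := integral_sub (i1.sub i2) i3
    have h3 := integral_sub ((i1.sub i2).sub i3) i4
    simp only [Pi.sub_apply] at h2 h3
    rw [← integral_const_mul, ← integral_const_mul, ← h1, ← h2, ← h3]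
    congr 1 with x
    ring
  rw [hsplit, hp, hE]
  set X := ∑ i, ∫ x, w i x ^ 2
  set Y := ∑ i, ∑ j, ∫ x, pdS j (w i) x ^ 2
  set s := √(∑ i, ∑ j, ∫ x, pdS j (u i) x ^ 2)
    * √(∑ i, ∑ j, ∑ k, ∫ x, pdS k (pdS j (u i)) x ^ 2)
  set T := ∑ i, ∫ x, M i x * (w i x - α ^ 2 * lap (w i) x)
  set Λ := ∑ i, ∫ x, lap (w i) x * (w i x - α ^ 2 * lap (w i) x)
  have hX0 : 0 ≤ X := Finset.sum_nonneg fun i _ => nn _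
  have hY0 : 0 ≤ Y := Finset.sum_nonneg fun i _ => Finset.sum_nonneg fun j _ => nn _
  have hs0 : 0 ≤ s := mul_nonneg (Real.sqrt_nonneg _) (Real.sqrt_nonneg _)
  clear_value X Y s T Λ
  have hyoung : 18 * √(333 * (X * Y * s)) ≤ 2 * ν * Y + 14000 / ν * s * X := by
    refine le_of_abs_le (abs_le_of_sq_le_sq ?_ (by positivity))
    rw [mul_pow, Real.sq_sqrt (by positivity)]
    have h1 := four_mul_le_sq_add (2 * ν * Y) (14000 / ν * s * X)
    have h2 : 4 * (2 * ν * Y) * (14000 / ν * s * X) = 112000 * (X * Y * s) := by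
      field_simp
      ring
    have : 0 ≤ X * Y * s := by positivity
    linarith
  have h1 : ν * Λ ≤ ν * -Y := by gcongr
  have h2 : 0 ≤ β * (X + α ^ 2 * Y) := by positivity
  have h3 : 0 ≤ 14000 / ν * s * (α ^ 2 * Y) := by positivity
  have h4 := neg_le_of_abs_le hT
  linarith

end Energy

/-- Grönwall's inequality with a continuous time-dependent rate. -/
lemma le_mul_exp_integral_of_hasDerivAt_le {E E' K : ℝ → ℝ} (hE : ContinuousOn E (Ici 0))
    (hK : ContinuousOn K (Ici 0)) (hd : ∀ t > 0, HasDerivAt E (E' t) t)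
    (hle : ∀ t > 0, E' t ≤ K t * E t) {t : ℝ} (ht : 0 ≤ t) :
    E t ≤ E 0 * Real.exp (∫ s in (0 : ℝ)..t, K s) := by
  set k : ℝ → ℝ := fun s => K (max s 0) with hk
  have hkc : Continuous k := by
    rw [← continuousOn_univ]
    exact hK.comp (f := fun s => max s 0) (by fun_prop) fun s _ => le_max_right s 0
  have hkd : ∀ t, HasDerivAt (fun t => ∫ s in (0 : ℝ)..t, k s) (k t) t := fun t =>
    intervalIntegral.integral_hasDerivAt_right (hkc.intervalIntegrable _ _)
      hkc.stronglyMeasurable.stronglyMeasurableAtFilter hkc.continuousAt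
  have hFd : ∀ t > 0, HasDerivAt (fun t => E t * Real.exp (-∫ s in (0 : ℝ)..t, k s))
      (E' t * Real.exp (-∫ s in (0 : ℝ)..t, k s)
        + E t * (Real.exp (-∫ s in (0 : ℝ)..t, k s) * -k t)) t := fun t ht =>
    (hd t ht).mul (hkd t).neg.exp
  have hanti : AntitoneOn (fun t => E t * Real.exp (-∫ s in (0 : ℝ)..t, k s)) (Ici 0) := by
    refine antitoneOn_of_deriv_nonpos (convex_Ici 0) ?_ ?_ ?_
    · refine hE.mul (Continuous.continuousOn ?_)
      exact (continuous_iff_continuousAt.2 fun t => (hkd t).continuousAt).neg.rexp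
    · rw [interior_Ici]
      exact fun t ht => (hFd t ht).differentiableAt.differentiableWithinAt
    · rw [interior_Ici]
      intro t ht
      rw [(hFd t ht).deriv]
      have h1 : k t = K t := by simp [hk, max_eq_left (mem_Ioi.1 ht).le]
      have h2 := mul_le_mul_of_nonneg_right (hle t ht)
        (Real.exp_pos (-∫ s in (0 : ℝ)..t, k s)).le
      rw [h1]
      linarith
  have h := hanti (mem_Ici.2 le_rfl) (mem_Ici.2 ht) ht
  have hkK : ∫ s in (0 : ℝ)..t, k s = ∫ s in (0 : ℝ)..t, K s := by
    refine intervalIntegral.integral_congr fun s hs => ?_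
    rw [uIcc_of_le ht] at hs
    simp [hk, max_eq_left hs.1]
  simp only [intervalIntegral.integral_same, neg_zero, Real.exp_zero, mul_one, Real.exp_neg,
    hkK, ← div_eq_mul_inv] at h
  exact (div_le_iff₀ (Real.exp_pos _)).1 h

lemma pd_apply {g : V3 → Fin 3 → ℝ} (hg : Differentiable ℝ g) (j i : Fin 3) (x : V3) :
    pd j g x i = pdS j (fun y => g y i) x := by
  rw [pdS, fderiv_apply (hg x)]
  rfl

namespace IsSchwartz

variable {g : V3 → Fin 3 → ℝ}

lemma apply (hg : IsSchwartz g) (i : Fin 3) : IsSchwartz (fun x => g x i) :=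
  (hg.schwartzLocBdd.apply i).isSchwartz le_rfl

lemma pd_apply (hg : IsSchwartz g) (j i : Fin 3) (x : V3) :
    pd j g x i = pdS j (fun y => g y i) x :=
  _root_.pd_apply (hg.1.differentiable (by simp)) j i x

lemma pd_pd_apply (hg : IsSchwartz g) (k j i : Fin 3) (x : V3) :
    pd k (pd j g) x i = pdS k (pdS j (fun y => g y i)) x := by
  have hd : Differentiable ℝ (pd j g) :=
    ((hg.1.fderiv_right (m := (⊤ : ℕ∞)) (by simp)).clm_apply contDiff_const).differentiable
      (by simp)
  rw [_root_.pd_apply hd]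
  simp only [hg.pd_apply]

lemma sum_pd_pd_apply (hg : IsSchwartz g) (i : Fin 3) (x : V3) :
    ∑ j, pd j (pd j g) x i = _root_.lap (fun y => g y i) x := by
  simp only [hg.pd_pd_apply, _root_.lap]

lemma L2sq_eq (hg : IsSchwartz g) : L2sq g = ∑ i, ∫ x, g x i ^ 2 :=
  integral_finsetSum _ fun i _ => (hg.apply i).isDecaying.sq.integrable

lemma H1sq_eq (hg : IsSchwartz g) :
    H1sq g = ∑ i, ∑ j, ∫ x, pdS j (fun y => g y i) x ^ 2 := by
  have hd := fun i j => ((hg.apply i).partialDeriv j).isDecaying.sq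
  simp only [H1sq, hg.pd_apply]
  rw [integral_finsetSum _ fun i _ => (IsDecaying.sum fun j _ => hd i j).integrable]
  exact Finset.sum_congr rfl fun i _ => integral_finsetSum _ fun j _ => (hd i j).integrable

lemma H2sq_eq (hg : IsSchwartz g) :
    H2sq g = ∑ i, ∑ j, ∑ k, ∫ x, pdS k (pdS j (fun y => g y i)) x ^ 2 := by
  have hd := fun i j k => (((hg.apply i).partialDeriv j).partialDeriv k).isDecaying.sq
  simp only [H2sq, hg.pd_pd_apply]
  rw [integral_finsetSum _ fun i _ =>
    (IsDecaying.sum fun j _ => IsDecaying.sum fun k _ => hd i j k).integrable]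
  refine Finset.sum_congr rfl fun i _ => ?_
  rw [integral_finsetSum _ fun j _ => (IsDecaying.sum fun k _ => hd i j k).integrable]
  exact Finset.sum_congr rfl fun j _ => integral_finsetSum _ fun k _ => (hd i j k).integrable

lemma H1aSq_eq (hg : IsSchwartz g) (α : ℝ) :
    H1aSq α g = ∑ i, ∫ x, g x i * (g x i - α ^ 2 * _root_.lap (fun y => g y i) x) := by
  rw [H1aSq, hg.L2sq_eq, hg.H1sq_eq, Finset.mul_sum, ← Finset.sum_add_distrib]
  exact Finset.sum_congr rfl fun i _ => ((hg.apply i).integral_mul_helmholtz_self α).symm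

end IsSchwartz

namespace SchwartzLocBdd

variable {u : ℝ → V3 → Fin 3 → ℝ}

lemma continuousOn_L2sq (hu : SchwartzLocBdd u) :
    ContinuousOn (fun t => L2sq (u t)) (Ici 0) := by
  refine ContinuousOn.congr ?_ fun t ht => (hu.isSchwartz ht).L2sq_eq
  exact continuousOn_finsetSum _ fun i _ => (hu.apply i).locDecaying.sq.continuousOn_integral

lemma continuousOn_H1sq (hu : SchwartzLocBdd u) :
    ContinuousOn (fun t => H1sq (u t)) (Ici 0) := by
  refine ContinuousOn.congr ?_ fun t ht => (hu.isSchwartz ht).H1sq_eq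
  exact continuousOn_finsetSum _ fun i _ => continuousOn_finsetSum _ fun j _ =>
    ((hu.apply i).partialDeriv j).locDecaying.sq.continuousOn_integral

lemma continuousOn_H2sq (hu : SchwartzLocBdd u) :
    ContinuousOn (fun t => H2sq (u t)) (Ici 0) := by
  refine ContinuousOn.congr ?_ fun t ht => (hu.isSchwartz ht).H2sq_eq
  exact continuousOn_finsetSum _ fun i _ => continuousOn_finsetSum _ fun j _ =>
    continuousOn_finsetSum _ fun k _ =>
      (((hu.apply i).partialDeriv j).partialDeriv k).locDecaying.sq.continuousOn_integral

end SchwartzLocBdd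

namespace ClassicalSolution

variable {α β ν : ℝ} {u₀ f : V3 → Fin 3 → ℝ}

lemma hasDerivAt_u (sol : ClassicalSolution α β ν u₀ f) {t : ℝ} (ht : 0 < t) (x : V3)
    (i : Fin 3) :
    HasDerivAt (fun s => sol.u s x i) (f x i - β * sol.u t x i - sol.N t x i
      + ν * lap (fun y => sol.u t y i) x - pdS i (sol.p t) x) t := by
  have hcd : ContDiffOn ℝ (⊤ : ℕ∞) (fun s => sol.u s x i) (Ici 0) :=
    (sol.reg_u.apply i).1.comp (f := fun s => (s, x)) (by fun_prop) fun s hs => ⟨hs, mem_univ x⟩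
  have h := (hcd.differentiableOn (by simp) t ht.le).hasDerivWithinAt.hasDerivAt (Ici_mem_nhds ht)
  have hm := sol.momentum t ht.le x i
  rw [(sol.reg_u.isSchwartz ht.le).sum_pd_pd_apply] at hm
  have e : f x i - β * sol.u t x i - sol.N t x i + ν * lap (fun y => sol.u t y i) x
      - pdS i (sol.p t) x = derivWithin (fun s => sol.u s x i) (Ici 0) t := by linarith
  rw [e]
  exact h

lemma sum_pdS_u (sol : ClassicalSolution α β ν u₀ f) {t : ℝ} (ht : 0 ≤ t) (x : V3) :
    ∑ j, pdS j (fun y => sol.u t y j) x = 0 := by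
  simpa only [(sol.reg_u.isSchwartz ht).pd_apply] using sol.divFree t ht x

lemma helmholtz_N (sol : ClassicalSolution α β ν u₀ f) {t : ℝ} (ht : 0 ≤ t) (i : Fin 3)
    (x : V3) : sol.N t x i - α ^ 2 * lap (fun y => sol.N t y i) x
      = ∑ j, sol.u t x j * pdS j (fun y => sol.u t y i) x := by
  have h := sol.filter t ht x i
  rw [(sol.reg_N.isSchwartz ht).sum_pd_pd_apply] at h
  simp only [(sol.reg_u.isSchwartz ht).pd_apply] at h
  linarith

end ClassicalSolution

/-- The differential inequality for the energy of the difference of two solutions. -/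
lemma ClassicalSolution.energy_deriv_le {α β ν : ℝ} (hβ : 0 < β) (hν : 0 < ν)
    {f u₀₁ u₀₂ : V3 → Fin 3 → ℝ} (sol₁ : ClassicalSolution α β ν u₀₁ f)
    (sol₂ : ClassicalSolution α β ν u₀₂ f) :
    ∃ E' : ℝ → ℝ, ∀ t > 0,
      HasDerivAt (fun t => H1aSq α (fun x i => sol₁.u t x i - sol₂.u t x i)) (E' t) t ∧
      E' t ≤ 14000 / ν * (√(H1sq (sol₁.u t)) * √(H2sq (sol₁.u t)))
        * H1aSq α (fun x i => sol₁.u t x i - sol₂.u t x i) := by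
  set w : Fin 3 → ℝ → V3 → ℝ := fun i t x => sol₁.u t x i - sol₂.u t x i with hw
  set M : Fin 3 → ℝ → V3 → ℝ := fun i t x => sol₁.N t x i - sol₂.N t x i with hM
  set q : ℝ → V3 → ℝ := fun t x => sol₁.p t x - sol₂.p t x with hq
  have hwS : ∀ i, SchwartzLocBdd (w i) := fun i => (sol₁.reg_u.apply i).sub (sol₂.reg_u.apply i)
  have hMS : ∀ i, SchwartzLocBdd (M i) := fun i => (sol₁.reg_N.apply i).sub (sol₂.reg_N.apply i)
  have hqS : SchwartzLocBdd q := sol₁.reg_p.sub sol₂.reg_p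
  set R : Fin 3 → ℝ → V3 → ℝ := fun i t x =>
    ν * lap (w i t) x - M i t x - pdS i (q t) x - β * w i t x with hR
  have hRS : ∀ i, LocDecaying (R i) := fun i =>
    (((((hwS i).lap.const_mul ν).sub (hMS i)).sub (hqS.partialDeriv i)).sub
      ((hwS i).const_mul β)).locDecaying
  have hE : ∀ t ≥ 0, H1aSq α (fun x i => sol₁.u t x i - sol₂.u t x i)
      = ∑ i, ∫ x, w i t x * (w i t x - α ^ 2 * lap (w i t) x) := fun t ht =>
    ((sol₁.reg_u.sub sol₂.reg_u).isSchwartz ht).H1aSq_eq α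
  have hder : ∀ i, ∀ t > 0, ∀ x, HasDerivAt (fun s => w i s x) (R i t x) t := by
    intro i t ht x
    have h1 := (sol₁.reg_u.apply i).isSchwartz ht.le
    have h2 := (sol₂.reg_u.apply i).isSchwartz ht.le
    have e : R i t x = (f x i - β * sol₁.u t x i - sol₁.N t x i
        + ν * lap (fun y => sol₁.u t y i) x - pdS i (sol₁.p t) x)
        - (f x i - β * sol₂.u t x i - sol₂.N t x i
        + ν * lap (fun y => sol₂.u t y i) x - pdS i (sol₂.p t) x) := by
      simp only [hR, hw, hM, hq, h1.lap_sub h2,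
        (sol₁.reg_p.isSchwartz ht.le).pdS_sub (sol₂.reg_p.isSchwartz ht.le)]
      ring
    rw [e]
    exact (sol₁.hasDerivAt_u ht x i).sub (sol₂.hasDerivAt_u ht x i)
  refine ⟨fun t => 2 * ∑ i, ∫ x, R i t x * (w i t x - α ^ 2 * lap (w i t) x),
    fun t ht => ⟨?_, ?_⟩⟩
  · have h := HasDerivAt.fun_sum (u := Finset.univ) fun i _ =>
      (hwS i).hasDerivAt_energy (hRS i) (hder i) α ht
    rw [← Finset.mul_sum] at h
    refine h.congr_of_eventuallyEq ?_
    filter_upwards [Ioi_mem_nhds ht] with s hs using hE s (mem_Ioi.1 hs).le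
  · have ht0 : 0 ≤ t := ht.le
    rw [hE t ht0, (sol₁.reg_u.isSchwartz ht0).H1sq_eq, (sol₁.reg_u.isSchwartz ht0).H2sq_eq]
    refine two_mul_sum_integral_mul_helmholtz_le (u := fun i x => sol₁.u t x i)
      (v := fun i x => sol₂.u t x i) (w := fun i => w i t) (M := fun i => M i t) (q := q t)
      (fun i => (sol₁.reg_u.apply i).isSchwartz ht0) (fun i => (sol₂.reg_u.apply i).isSchwartz ht0)
      (fun i => (hMS i).isSchwartz ht0) (hqS.isSchwartz ht0) hβ hν (sol₁.sum_pdS_u ht0)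
      (sol₂.sum_pdS_u ht0) (fun i x => ?_) fun i => rfl
    rw [← sol₁.helmholtz_N ht0, ← sol₂.helmholtz_N ht0]
    simp only [hM, ((sol₁.reg_N.apply i).isSchwartz ht0).lap_sub
      ((sol₂.reg_N.apply i).isSchwartz ht0)]
    ring

/-- Grönwall-type stability estimate for two solutions with the same force. -/
theorem gronwall_stability :
    ∃ c : ℝ, 0 < c ∧
    ∀ (α β ν : ℝ), 0 < α → 0 < β → 0 < ν →
    ∀ (f : V3 → Fin 3 → ℝ), IsForce f →
    ∀ (u₀₁ u₀₂ : V3 → Fin 3 → ℝ)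
      (sol₁ : ClassicalSolution α β ν u₀₁ f) (sol₂ : ClassicalSolution α β ν u₀₂ f),
      ∀ t ≥ (0:ℝ),
        H1aSq α (fun x i => sol₁.u t x i - sol₂.u t x i)
          ≤ H1aSq α (fun x i => u₀₁ x i - u₀₂ x i)
            * Real.exp (c / ν *
                ∫ s in (0:ℝ)..t, Real.sqrt (H1sq (sol₁.u s)) * Real.sqrt (H2sq (sol₁.u s))) := by
  refine ⟨14000, by norm_num, fun α β ν _ hβ hν f _ u₀₁ u₀₂ sol₁ sol₂ t ht => ?_⟩
  obtain ⟨E', hE'⟩ := sol₁.energy_deriv_le hβ hν sol₂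
  have hw : SchwartzLocBdd (fun t x i => sol₁.u t x i - sol₂.u t x i) :=
    sol₁.reg_u.sub sol₂.reg_u
  have hE : ContinuousOn (fun t => H1aSq α (fun x i => sol₁.u t x i - sol₂.u t x i)) (Ici 0) :=
    hw.continuousOn_L2sq.add (continuousOn_const.mul hw.continuousOn_H1sq)
  have hK : ContinuousOn (fun s => 14000 / ν * (√(H1sq (sol₁.u s)) * √(H2sq (sol₁.u s))))
      (Ici 0) :=
    continuousOn_const.mul (sol₁.reg_u.continuousOn_H1sq.sqrt.mul sol₁.reg_u.continuousOn_H2sq.sqrt)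
  have h := le_mul_exp_integral_of_hasDerivAt_le hE hK (fun t ht => (hE' t ht).1)
    (fun t ht => (hE' t ht).2) ht
  rw [intervalIntegral.integral_const_mul] at h
  simpa only [sol₁.init, sol₂.init] using h

end
end

section
/- There exists an absolute constant c > 0 such that for every T ∈ (0,∞) and every function u : [0,T] × ℝ³ → ℝ³ that is continuous in t and Schwartz class in x (with Schwartz seminorms bounded on [0,T]), one has ( ∫₀ᵀ ‖u(t,·) ⊗ u(t,·)‖²_{Ḣ¹} dt )^{1/2} ≤ c T^{1/4} ( sup_{0 ≤ t ≤ T} ( ‖u(t,·)‖²_{L²} + ‖u(t,·)‖²_{Ḣ¹} )^{1/2} + ( ∫₀ᵀ ‖u(t,·)‖²_{Ḣ²} dt )^{1/2} )², where (u ⊗ u)_{ij} = u_i u_j. -/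
open MeasureTheory Set

noncomputable section

open scoped ENNReal NNReal SchwartzMap LineDeriv
open Filter Topology

theorem norm_le_sum_apply_single (L : V3 →L[ℝ] ℝ) :
    ‖L‖ ≤ ∑ k, |L (Pi.single k 1)| := by
  refine L.opNorm_le_bound (Finset.sum_nonneg fun _ _ => abs_nonneg _) fun v => ?_
  have hv : v = ∑ k, v k • (Pi.single k (1 : ℝ) : V3) := by
    simpa using (pi_eq_sum_univ' v)
  conv_lhs => rw [hv, map_sum]
  refine (norm_sum_le _ _).trans ?_
  rw [Finset.sum_mul]
  refine Finset.sum_le_sum fun k _ => ?_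
  rw [map_smul, norm_smul, mul_comm]
  exact mul_le_mul_of_nonneg_left (norm_le_pi_norm v k) (norm_nonneg _)

theorem sq_norm_le_sum_sq_apply_single (L : V3 →L[ℝ] ℝ) :
    ‖L‖ ^ 2 ≤ 3 * ∑ k, L (Pi.single k 1) ^ 2 := by
  refine (pow_le_pow_left₀ (norm_nonneg _) (norm_le_sum_apply_single L) 2).trans ?_
  simpa using sq_sum_le_card_mul_sum_sq (s := Finset.univ) (f := fun k => |L (Pi.single k 1)|)

/-- The Sobolev inequality `‖f‖_{L⁶} ≲ ‖Df‖_{L²}` on `ℝ³`, extended from compactly supported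
functions to Schwartz functions by cutting off. -/
theorem eLpNorm_six_le_eLpNorm_fderiv (f : 𝓢(V3, ℝ)) :
    eLpNorm f 6 volume ≤
      SNormLESNormFDerivOfEqConst ℝ (volume : Measure V3) 2 * eLpNorm (fderiv ℝ f) 2 volume := by
  set C := SNormLESNormFDerivOfEqConst ℝ (volume : Measure V3) 2
  let b : ContDiffBump (0 : V3) := ⟨1, 2, one_pos, one_lt_two⟩
  have hb : ContDiff ℝ 1 b := b.contDiff
  obtain ⟨M, hM⟩ := (b.hasCompactSupport.fderiv (𝕜 := ℝ)).exists_bound_of_continuous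
    (hb.continuous_fderiv one_ne_zero)
  have hM0 : 0 ≤ M := (norm_nonneg _).trans (hM 0)
  let ε : ℕ → ℝ := fun n => ((n : ℝ) + 1)⁻¹
  have hε : ∀ n, 0 < ε n := fun n => by positivity
  have hε0 : Tendsto ε atTop (𝓝 0) := by
    simpa [ε] using tendsto_one_div_add_atTop_nhds_zero_nat (𝕜 := ℝ)
  let χ : ℕ → V3 → ℝ := fun n x => b (ε n • x)
  have hχ : ∀ n, ContDiff ℝ 1 (χ n) := fun n => hb.comp (contDiff_const_smul (ε n))
  have hfs : ContDiff ℝ 1 f := f.smooth 1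
  have hderiv : ∀ n x, ‖fderiv ℝ (fun y => χ n y * f y) x‖
      ≤ ‖fderiv ℝ f x‖ + (M * ε n) * ‖f x‖ := by
    intro n x
    have h1 : ‖fderiv ℝ (χ n) x‖ ≤ M * ε n := by
      have := fderiv_comp_smul (𝕜 := ℝ) (f := b) (c := ε n) (x := x)
      simp only [χ]
      rw [this, norm_smul, Real.norm_of_nonneg (hε n).le, mul_comm]
      exact mul_le_mul_of_nonneg_right (hM _) (hε n).le
    have h2 : ‖χ n x‖ ≤ 1 := by
      rw [Real.norm_of_nonneg b.nonneg]; exact b.le_one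
    rw [fderiv_fun_mul ((hχ n).differentiable one_ne_zero x)
      (hfs.differentiable one_ne_zero x)]
    refine (norm_add_le _ _).trans ?_
    rw [norm_smul, norm_smul, mul_comm ‖f x‖]
    gcongr
    exact mul_le_of_le_one_left (norm_nonneg _) h2
  have hcpt : ∀ n, HasCompactSupport (fun y => χ n y * f y) := by
    intro n
    refine HasCompactSupport.mul_right ?_
    exact b.hasCompactSupport.comp_homeomorph (Homeomorph.smulOfNeZero (ε n) (hε n).ne')
  have hn : ∀ n, eLpNorm (fun y => χ n y * f y) 6 volume
      ≤ C * (eLpNorm (fderiv ℝ f) 2 volume + ENNReal.ofReal (M * ε n) * eLpNorm f 2 volume) := by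
    intro n
    have h := eLpNorm_le_eLpNorm_fderiv_of_eq (volume : Measure V3) ((hχ n).mul hfs) (hcpt n)
      (p := 2) (p' := 6) (by norm_num) (by simp) (by simp; norm_num)
    simp only [NNReal.coe_ofNat, ENNReal.coe_ofNat] at h
    refine h.trans ?_
    gcongr
    refine (eLpNorm_mono_real (hderiv n)).trans ?_
    refine (eLpNorm_add_le ?_ ?_ ?_).trans ?_
    · exact (hfs.continuous_fderiv one_ne_zero).norm.aestronglyMeasurable
    · exact (continuous_const.mul hfs.continuous.norm).aestronglyMeasurable
    · norm_num
    · gcongr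
      · exact (eLpNorm_norm _).le
      · have := eLpNorm_const_smul (M * ε n) (fun x => ‖f x‖) 2 (volume : Measure V3)
        rw [eLpNorm_norm] at this
        refine this.le.trans ?_
        gcongr
        rw [← ofReal_norm, Real.norm_of_nonneg (mul_nonneg hM0 (hε n).le)]
  have hlim : ∀ x, Tendsto (fun n => χ n x * f x) atTop (𝓝 (f x)) := by
    intro x
    have h1 : Tendsto (fun n => χ n x) atTop (𝓝 (b ((0 : ℝ) • x))) :=
      (hb.continuous.tendsto _).comp (hε0.smul_const x)
    have h0 : b ((0 : ℝ) • x) = 1 := by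
      rw [zero_smul]; exact b.one_of_mem_closedBall (by simp [b])
    rw [h0] at h1
    simpa using h1.mul_const (f x)
  refine (Lp.eLpNorm_lim_le_liminf_eLpNorm (fun n => ((hχ n).mul hfs).continuous.aestronglyMeasurable)
    f (ae_of_all _ hlim)).trans ?_
  refine (liminf_le_liminf (Eventually.of_forall hn)).trans (le_of_eq ?_)
  refine Tendsto.liminf_eq ?_
  have h2 : Tendsto (fun n => ENNReal.ofReal (M * ε n) * eLpNorm f 2 volume) atTop (𝓝 0) := by
    have h3 : Tendsto (fun n => ENNReal.ofReal (M * ε n)) atTop (𝓝 0) := by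
      simpa using ENNReal.tendsto_ofReal (hε0.const_mul M)
    simpa using ENNReal.Tendsto.mul_const h3 (Or.inr (f.memLp 2 volume).eLpNorm_ne_top)
  simpa using ENNReal.Tendsto.const_mul (tendsto_const_nhds.add h2) (Or.inr ENNReal.coe_ne_top)

/-- The squared homogeneous `Ḣ¹` norm of a scalar function. -/
def gradSq (f : V3 → ℝ) : ℝ := ∫ x, ∑ k, pdS k f x ^ 2

theorem gradSq_nonneg (f : V3 → ℝ) : 0 ≤ gradSq f :=
  integral_nonneg fun _ => Finset.sum_nonneg fun _ _ => sq_nonneg _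

theorem SchwartzMap.integrable_sq (f : 𝓢(V3, ℝ)) : Integrable (fun x => f x ^ 2) :=
  (f.memLp 2 volume).integrable_sq

theorem SchwartzMap.lineDeriv_eq_pdS (f : 𝓢(V3, ℝ)) (k : Fin 3) :
    ⇑(∂_{(Pi.single k 1 : V3)} f : 𝓢(V3, ℝ)) = pdS k f := by
  ext x; exact SchwartzMap.lineDerivOp_apply_eq_fderiv _ _ _

theorem SchwartzMap.integrable_sq_pdS (f : 𝓢(V3, ℝ)) (k : Fin 3) :
    Integrable (fun x => pdS k f x ^ 2) := by
  rw [← f.lineDeriv_eq_pdS]; exact SchwartzMap.integrable_sq _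

theorem eLpNorm_fderiv_two_le (f : 𝓢(V3, ℝ)) :
    eLpNorm (fderiv ℝ f) 2 volume ≤ ENNReal.ofReal (2 * √(gradSq f)) := by
  have hInt : Integrable (fun x => ∑ k, pdS k f x ^ 2) :=
    integrable_finsetSum _ fun k _ => f.integrable_sq_pdS k
  have h : eLpNorm (fderiv ℝ f) 2 volume ^ 2 ≤ ENNReal.ofReal (2 * √(gradSq f)) ^ 2 := by
    rw [← ENNReal.ofReal_pow (by positivity), mul_pow, Real.sq_sqrt (gradSq_nonneg f)]
    have := eLpNorm_nnreal_pow_eq_lintegral (f := fderiv ℝ f) (μ := volume) (p := 2) (by norm_num)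
    norm_num at this
    rw [this, gradSq, ← integral_const_mul, ofReal_integral_eq_lintegral_ofReal
      (hInt.const_mul _)
      (ae_of_all _ fun x => mul_nonneg (by norm_num)
        (Finset.sum_nonneg fun _ _ => sq_nonneg _))]
    refine lintegral_mono fun x => ?_
    rw [← ofReal_norm, ← ENNReal.ofReal_pow (norm_nonneg _)]
    refine ENNReal.ofReal_le_ofReal ((sq_norm_le_sum_sq_apply_single _).trans ?_)
    have : 0 ≤ ∑ k, pdS k f x ^ 2 := Finset.sum_nonneg fun _ _ => sq_nonneg _
    simp only [pdS] at this ⊢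
    linarith
  exact (ENNReal.pow_le_pow_left_iff two_ne_zero).1 h

/-- `‖f‖_{L⁶} ≤ S ‖Df‖_{L²}` for Schwartz functions. -/
theorem exists_sobolev_const : ∃ S : ℝ, 0 < S ∧ ∀ f : 𝓢(V3, ℝ),
    eLpNorm f 6 volume ≤ ENNReal.ofReal (S * √(gradSq f)) := by
  set C := SNormLESNormFDerivOfEqConst ℝ (volume : Measure V3) 2
  refine ⟨(C + 1) * 2, by positivity, fun f => (eLpNorm_six_le_eLpNorm_fderiv f).trans ?_⟩
  rw [mul_assoc, ENNReal.ofReal_mul (by positivity)]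
  refine mul_le_mul' ?_ (eLpNorm_fderiv_two_le f)
  rw [← ENNReal.ofReal_coe_nnreal]
  exact ENNReal.ofReal_le_ofReal (by simp [C])

theorem integrable_sq_mul (a b : 𝓢(V3, ℝ)) : Integrable (fun x => (a x * b x) ^ 2) :=
  ((b.memLp 2 volume).mul (a.memLp ∞ volume)).integrable_sq

/-- Hölder's inequality with exponents `3, 2, 6` for `∫ a² |b| |b|`. -/
theorem lintegral_sq_mul_sq_le (a b : 𝓢(V3, ℝ)) :
    ∫⁻ x, ‖a x‖ₑ ^ 2 * ‖b x‖ₑ ^ 2 ≤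
      eLpNorm a 6 volume ^ 2 * (eLpNorm b 2 volume * eLpNorm b 6 volume) := by
  have ma : Measurable fun x => ‖a x‖ₑ := a.continuous.measurable.enorm
  have mb : Measurable fun x => ‖b x‖ₑ := b.continuous.measurable.enorm
  have h := ENNReal.lintegral_prod_norm_pow_le (μ := (volume : Measure V3)) (Finset.univ : Finset (Fin 3))
    (f := ![fun x => ‖a x‖ₑ ^ (6 : ℝ), fun x => ‖b x‖ₑ ^ (2 : ℝ), fun x => ‖b x‖ₑ ^ (6 : ℝ)])
    (p := ![1 / 3, 1 / 2, 1 / 6])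
    (by
      intro i _
      fin_cases i
      · exact (ma.pow_const _).aemeasurable
      · exact (mb.pow_const _).aemeasurable
      · exact (mb.pow_const _).aemeasurable)
    (by simp [Fin.sum_univ_three]; norm_num)
    (by intro i _; fin_cases i <;> simp)
  simp only [Fin.prod_univ_three, Matrix.cons_val_zero, Matrix.cons_val_one, Matrix.cons_val,
    ← ENNReal.rpow_mul] at h
  have e6 := fun f : 𝓢(V3, ℝ) => eLpNorm_nnreal_pow_eq_lintegral (f := f) (μ := (volume : Measure V3))
    (p := 6) (by norm_num)
  have e2 := fun f : 𝓢(V3, ℝ) => eLpNorm_nnreal_pow_eq_lintegral (f := f) (μ := (volume : Measure V3))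
    (p := 2) (by norm_num)
  simp only [NNReal.coe_ofNat, ENNReal.coe_ofNat] at e6 e2
  rw [← e6, ← e6, ← e2, ← ENNReal.rpow_mul, ← ENNReal.rpow_mul, ← ENNReal.rpow_mul] at h
  norm_num at h
  simpa only [mul_assoc, ← sq] using h

theorem exists_integral_sq_mul_le : ∃ K : ℝ, 0 < K ∧ ∀ a b : 𝓢(V3, ℝ),
    ∫ x, (a x * b x) ^ 2 ≤ K * (gradSq a * (√(∫ x, b x ^ 2) * √(gradSq b))) := by
  obtain ⟨S, hS, h6⟩ := exists_sobolev_const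
  refine ⟨S ^ 3, by positivity, fun a b => ?_⟩
  have hb2 : eLpNorm b 2 volume = ENNReal.ofReal √(∫ x, b x ^ 2) := by
    apply (ENNReal.pow_right_strictMono two_ne_zero).injective
    dsimp only
    rw [← ENNReal.ofReal_pow (Real.sqrt_nonneg _),
      Real.sq_sqrt (integral_nonneg fun _ => sq_nonneg _),
      ofReal_integral_eq_lintegral_ofReal b.integrable_sq (ae_of_all _ fun _ => sq_nonneg _)]
    have e2 := eLpNorm_nnreal_pow_eq_lintegral (f := b) (μ := (volume : Measure V3))
      (p := 2) (by norm_num)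
    norm_num at e2
    rw [e2]
    refine lintegral_congr fun x => ?_
    rw [← ofReal_norm, ← ENNReal.ofReal_pow (norm_nonneg _), Real.norm_eq_abs, sq_abs]
  rw [← ENNReal.ofReal_le_ofReal_iff (by have := gradSq_nonneg a; positivity),
    ofReal_integral_eq_lintegral_ofReal (integrable_sq_mul a b) (ae_of_all _ fun _ => sq_nonneg _)]
  calc ∫⁻ x, ENNReal.ofReal ((a x * b x) ^ 2)
      = ∫⁻ x, ‖a x‖ₑ ^ 2 * ‖b x‖ₑ ^ 2 := by
        refine lintegral_congr fun x => ?_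
        rw [← mul_pow, ← enorm_mul, ← ofReal_norm, ← ENNReal.ofReal_pow (norm_nonneg _),
          Real.norm_eq_abs, sq_abs]
    _ ≤ _ := lintegral_sq_mul_sq_le a b
    _ ≤ ENNReal.ofReal (S * √(gradSq a)) ^ 2 *
        (ENNReal.ofReal √(∫ x, b x ^ 2) * ENNReal.ofReal (S * √(gradSq b))) := by
        rw [hb2]
        gcongr
        · exact h6 a
        · exact h6 b
    _ = _ := by
        rw [← ENNReal.ofReal_pow (by positivity), ← ENNReal.ofReal_mul (by positivity),
          ← ENNReal.ofReal_mul (by positivity), mul_pow, Real.sq_sqrt (gradSq_nonneg a)]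
        congr 1
        ring

/-- The `i`-th component of a Schwartz vector field as a scalar Schwartz function. -/
def IsSchwartz.component {g : V3 → Fin 3 → ℝ} (hg : IsSchwartz g) (i : Fin 3) : 𝓢(V3, ℝ) :=
  SchwartzMap.postcompCLM (𝕜 := ℝ) (ContinuousLinearMap.proj (R := ℝ) (φ := fun _ : Fin 3 => ℝ) i)
    ⟨g, hg.1, hg.2⟩

variable {g : V3 → Fin 3 → ℝ}

theorem IsSchwartz.component_apply (hg : IsSchwartz g) (i : Fin 3) (x : V3) :
    hg.component i x = g x i := rfl

theorem pd_apply_eq_pdS {x : V3} (hg : DifferentiableAt ℝ g x) (j i : Fin 3) :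
    pd j g x i = pdS j (fun y => g y i) x := by
  rw [pd, pdS, fderiv_apply hg]
  rfl

theorem IsSchwartz.pd (hg : IsSchwartz g) (j : Fin 3) : IsSchwartz (pd j g) := by
  let G : 𝓢(V3, Fin 3 → ℝ) := ⟨g, hg.1, hg.2⟩
  have h : (∂_{(Pi.single j 1 : V3)} G : 𝓢(V3, Fin 3 → ℝ)) = _root_.pd j g :=
    funext fun x => SchwartzMap.lineDerivOp_apply_eq_fderiv _ _ _
  rw [← h]
  exact ⟨SchwartzMap.smooth' _, SchwartzMap.decay' _⟩

theorem IsSchwartz.pdS_component (hg : IsSchwartz g) (j i : Fin 3) :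
    pdS j (hg.component i) = (hg.pd j).component i := by
  ext x
  exact (pd_apply_eq_pdS (hg.1.differentiable (by simp) x) j i).symm

theorem IsSchwartz.integrable_sq (hg : IsSchwartz g) (i : Fin 3) :
    Integrable fun x => g x i ^ 2 :=
  (hg.component i).integrable_sq

theorem IsSchwartz.gradSq_component_le (hg : IsSchwartz g) (i : Fin 3) :
    gradSq (hg.component i) ≤ H1sq g := by
  refine integral_mono (integrable_finsetSum _ fun k _ => (hg.component i).integrable_sq_pdS k)
    (integrable_finsetSum _ fun i _ => integrable_finsetSum _ fun j _ => (hg.pd j).integrable_sq i)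
    fun x => ?_
  simp only [hg.pdS_component, IsSchwartz.component_apply]
  exact Finset.single_le_sum (f := fun i => ∑ k, _root_.pd k g x i ^ 2)
    (fun _ _ => Finset.sum_nonneg fun _ _ => sq_nonneg _) (Finset.mem_univ i)

theorem IsSchwartz.integral_sq_pd_le (hg : IsSchwartz g) (k i : Fin 3) :
    ∫ x, _root_.pd k g x i ^ 2 ≤ H1sq g := by
  refine integral_mono ((hg.pd k).integrable_sq i)
    (integrable_finsetSum _ fun i _ => integrable_finsetSum _ fun j _ => (hg.pd j).integrable_sq i)
    fun x => ?_
  exact (Finset.single_le_sum (f := fun k => _root_.pd k g x i ^ 2)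
    (fun _ _ => sq_nonneg _) (Finset.mem_univ k)).trans
    (Finset.single_le_sum (f := fun i => ∑ k, _root_.pd k g x i ^ 2)
    (fun _ _ => Finset.sum_nonneg fun _ _ => sq_nonneg _) (Finset.mem_univ i))

theorem IsSchwartz.H1sq_pd_le (hg : IsSchwartz g) (j : Fin 3) :
    H1sq (_root_.pd j g) ≤ H2sq g := by
  refine integral_mono
    (integrable_finsetSum _ fun i _ => integrable_finsetSum _ fun k _ =>
      ((hg.pd j).pd k).integrable_sq i)
    (integrable_finsetSum _ fun i _ => integrable_finsetSum _ fun j _ =>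
      integrable_finsetSum _ fun k _ => ((hg.pd j).pd k).integrable_sq i)
    fun x => ?_
  exact Finset.sum_le_sum fun i _ =>
    Finset.single_le_sum (f := fun j => ∑ k, _root_.pd k (_root_.pd j g) x i ^ 2)
    (fun _ _ => Finset.sum_nonneg fun _ _ => sq_nonneg _) (Finset.mem_univ j)

theorem H1sq_nonneg (g : V3 → Fin 3 → ℝ) : 0 ≤ H1sq g :=
  integral_nonneg fun _ => Finset.sum_nonneg fun _ _ => Finset.sum_nonneg fun _ _ => sq_nonneg _

/-- The squared `Ḣ¹` norm of `g ⊗ g` is controlled by `‖g‖_{Ḣ¹}³ ‖g‖_{Ḣ²}`. -/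
theorem exists_tensor_H1_le : ∃ K : ℝ, 0 < K ∧ ∀ g : V3 → Fin 3 → ℝ, IsSchwartz g →
    ∫ x : V3, ∑ i, ∑ j, ∑ k, (pdS k (fun y => g y i * g y j) x) ^ 2
      ≤ K * (H1sq g * √(H1sq g) * √(H2sq g)) := by
  obtain ⟨K, hK, hprod⟩ := exists_integral_sq_mul_le
  refine ⟨108 * K, by positivity, fun g hg => ?_⟩
  set R := K * (H1sq g * √(H1sq g) * √(H2sq g))
  have hR : ∀ i j k : Fin 3, ∫ x, (g x i * pd k g x j) ^ 2 ≤ R := by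
    intro i j k
    refine (hprod (hg.component i) ((hg.pd k).component j)).trans ?_
    simp only [R, mul_assoc]
    gcongr
    · exact H1sq_nonneg g
    · exact hg.gradSq_component_le i
    · exact hg.integral_sq_pd_le k j
    · exact ((hg.pd k).gradSq_component_le j).trans (hg.H1sq_pd_le k)
  have hI : ∀ i j k : Fin 3, Integrable fun x => (g x i * pd k g x j) ^ 2 :=
    fun i j k => integrable_sq_mul (hg.component i) ((hg.pd k).component j)
  have hI2 : ∀ i j k : Fin 3, Integrable fun x =>
      2 * ((g x i * pd k g x j) ^ 2 + (g x j * pd k g x i) ^ 2) :=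
    fun i j k => ((hI i j k).add (hI j i k)).const_mul 2
  have hpt : ∀ x, ∑ i, ∑ j, ∑ k, (pdS k (fun y => g y i * g y j) x) ^ 2
      ≤ ∑ i, ∑ j, ∑ k, 2 * ((g x i * pd k g x j) ^ 2 + (g x j * pd k g x i) ^ 2) := by
    intro x
    refine Finset.sum_le_sum fun i _ => Finset.sum_le_sum fun j _ => Finset.sum_le_sum fun k _ => ?_
    have hd : DifferentiableAt ℝ g x := hg.1.differentiable (by simp) x
    have hi : ∀ i, DifferentiableAt ℝ (fun y => g y i) x := fun i => differentiableAt_pi.1 hd i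
    have : pdS k (fun y => g y i * g y j) x = g x i * pd k g x j + g x j * pd k g x i := by
      rw [pd_apply_eq_pdS hd, pd_apply_eq_pdS hd]
      simp only [pdS]
      rw [fderiv_fun_mul (hi i) (hi j)]
      simp
    rw [this]
    exact add_sq_le
  calc _ ≤ ∫ x, ∑ i, ∑ j, ∑ k, 2 * ((g x i * pd k g x j) ^ 2 + (g x j * pd k g x i) ^ 2) :=
        integral_mono_of_nonneg
          (ae_of_all _ fun x => Finset.sum_nonneg fun _ _ => Finset.sum_nonneg fun _ _ =>
            Finset.sum_nonneg fun _ _ => sq_nonneg _)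
          (integrable_finsetSum _ fun i _ => integrable_finsetSum _ fun j _ =>
            integrable_finsetSum _ fun k _ => hI2 i j k)
          (ae_of_all _ hpt)
    _ = ∑ i, ∑ j, ∑ k, ∫ x, 2 * ((g x i * pd k g x j) ^ 2 + (g x j * pd k g x i) ^ 2) := by
        rw [integral_finsetSum _ fun i _ => integrable_finsetSum _ fun j _ =>
          integrable_finsetSum _ fun k _ => hI2 i j k]
        refine Finset.sum_congr rfl fun i _ => ?_
        rw [integral_finsetSum _ fun j _ => integrable_finsetSum _ fun k _ => hI2 i j k]
        refine Finset.sum_congr rfl fun j _ => ?_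
        rw [integral_finsetSum _ fun k _ => hI2 i j k]
    _ ≤ ∑ i : Fin 3, ∑ j : Fin 3, ∑ k : Fin 3, 4 * R := by
        refine Finset.sum_le_sum fun i _ => Finset.sum_le_sum fun j _ =>
          Finset.sum_le_sum fun k _ => ?_
        rw [integral_const_mul, integral_add (hI i j k) (hI j i k)]
        linarith [hR i j k, hR j i k]
    _ = 108 * K * (H1sq g * √(H1sq g) * √(H2sq g)) := by
        simp [R]; ring

/-- A family of functions that are Schwartz, with seminorms bounded uniformly over `t ∈ s`. -/
def UniformlySchwartzOn (s : Set ℝ) (u : ℝ → V3 → Fin 3 → ℝ) : Prop :=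
  (∀ t ∈ s, ContDiff ℝ (⊤ : ℕ∞) (u t)) ∧
  ∀ k n : ℕ, ∃ C : ℝ, ∀ t ∈ s, ∀ x : V3, ‖x‖ ^ k * ‖iteratedFDeriv ℝ n (u t) x‖ ≤ C

variable {s : Set ℝ} {u : ℝ → V3 → Fin 3 → ℝ}

theorem UniformlySchwartzOn.isSchwartz (hu : UniformlySchwartzOn s u) {t : ℝ} (ht : t ∈ s) :
    IsSchwartz (u t) :=
  ⟨hu.1 t ht, fun k n => (hu.2 k n).imp fun _ hC => hC t ht⟩

theorem UniformlySchwartzOn.pd (hu : UniformlySchwartzOn s u) (j : Fin 3) :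
    UniformlySchwartzOn s fun t => pd j (u t) := by
  refine ⟨fun t ht => ((hu.isSchwartz ht).pd j).1, fun k n => ?_⟩
  obtain ⟨C, hC⟩ := hu.2 k (n + 1)
  let L : (V3 →L[ℝ] Fin 3 → ℝ) →L[ℝ] Fin 3 → ℝ :=
    ContinuousLinearMap.apply ℝ (Fin 3 → ℝ) (Pi.single j 1 : V3)
  refine ⟨‖L‖ * C, fun t ht x => ?_⟩
  have h : ‖iteratedFDeriv ℝ n (_root_.pd j (u t)) x‖
      ≤ ‖L‖ * ‖iteratedFDeriv ℝ n (fderiv ℝ (u t)) x‖ :=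
    L.norm_iteratedFDeriv_comp_left (N := n)
      (((hu.1 t ht).fderiv_right (m := n) (by exact_mod_cast le_top)).contDiffAt) le_rfl
  rw [norm_iteratedFDeriv_fderiv] at h
  calc _ ≤ ‖x‖ ^ k * (‖L‖ * ‖iteratedFDeriv ℝ (n + 1) (u t) x‖) := by gcongr
    _ = ‖L‖ * (‖x‖ ^ k * ‖iteratedFDeriv ℝ (n + 1) (u t) x‖) := by ring
    _ ≤ _ := by gcongr; exact hC t ht x

theorem UniformlySchwartzOn.exists_L2sq_le (hu : UniformlySchwartzOn s u) :
    ∃ B, ∀ t ∈ s, L2sq (u t) ≤ B := by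
  obtain ⟨C₀, h₀⟩ := hu.2 0 0
  obtain ⟨C₂, h₂⟩ := hu.2 2 0
  have hInt : Integrable fun x : V3 => (1 + ‖x‖) ^ (-4 : ℝ) :=
    integrable_one_add_norm (by simp; norm_num)
  refine ⟨∫ x : V3, 3 * (2 * (C₀ + C₂)) ^ 2 * (1 + ‖x‖) ^ (-4 : ℝ), fun t ht => ?_⟩
  refine integral_mono (integrable_finsetSum _ fun i _ => (hu.isSchwartz ht).integrable_sq i)
    (hInt.const_mul _) fun x => ?_
  have h0 := h₀ t ht x
  have h2 := h₂ t ht x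
  simp only [norm_iteratedFDeriv_zero, pow_zero, one_mul] at h0 h2
  have hb : (1 + ‖x‖) ^ 2 * ‖u t x‖ ≤ 2 * (C₀ + C₂) := by
    nlinarith [mul_nonneg (sq_nonneg (1 - ‖x‖)) (norm_nonneg (u t x))]
  have hpos : 0 < 1 + ‖x‖ := by positivity
  have hsq : ‖u t x‖ ^ 2 ≤ (2 * (C₀ + C₂)) ^ 2 * (1 + ‖x‖) ^ (-4 : ℝ) := by
    have h4 : (1 + ‖x‖) ^ (-4 : ℝ) = ((1 + ‖x‖) ^ 4)⁻¹ := by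
      rw [Real.rpow_neg hpos.le]; norm_cast
    rw [h4, ← div_eq_mul_inv, le_div_iff₀ (by positivity)]
    calc _ = ((1 + ‖x‖) ^ 2 * ‖u t x‖) ^ 2 := by ring
      _ ≤ _ := by gcongr
  calc ∑ i, u t x i ^ 2 ≤ ∑ _i : Fin 3, ‖u t x‖ ^ 2 := by
        refine Finset.sum_le_sum fun i _ => ?_
        rw [← sq_abs]
        exact pow_le_pow_left₀ (abs_nonneg _) (norm_le_pi_norm (u t x) i) 2
    _ = 3 * ‖u t x‖ ^ 2 := by simp
    _ ≤ _ := by rw [mul_assoc]; gcongr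

theorem IsSchwartz.H1sq_eq_sum (hg : IsSchwartz g) : H1sq g = ∑ j, L2sq (_root_.pd j g) := by
  simp only [H1sq, L2sq]
  rw [← integral_finsetSum _ fun j _ =>
    integrable_finsetSum _ fun i _ => (hg.pd j).integrable_sq i]
  exact integral_congr_ae (ae_of_all _ fun x => Finset.sum_comm)

theorem IsSchwartz.H2sq_eq_sum (hg : IsSchwartz g) : H2sq g = ∑ j, H1sq (_root_.pd j g) := by
  simp only [H1sq, H2sq]
  rw [← integral_finsetSum _ fun j _ => integrable_finsetSum _ fun i _ =>
    integrable_finsetSum _ fun k _ => ((hg.pd j).pd k).integrable_sq i]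
  exact integral_congr_ae (ae_of_all _ fun x => Finset.sum_comm)

theorem UniformlySchwartzOn.exists_H1sq_le (hu : UniformlySchwartzOn s u) :
    ∃ B, ∀ t ∈ s, H1sq (u t) ≤ B := by
  choose B hB using fun j => (hu.pd j).exists_L2sq_le
  refine ⟨∑ j, B j, fun t ht => ?_⟩
  rw [(hu.isSchwartz ht).H1sq_eq_sum]
  exact Finset.sum_le_sum fun j _ => hB j t ht

theorem UniformlySchwartzOn.exists_H2sq_le (hu : UniformlySchwartzOn s u) :
    ∃ B, ∀ t ∈ s, H2sq (u t) ≤ B := by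
  choose B hB using fun j => (hu.pd j).exists_H1sq_le
  refine ⟨∑ j, B j, fun t ht => ?_⟩
  rw [(hu.isSchwartz ht).H2sq_eq_sum]
  exact Finset.sum_le_sum fun j _ => hB j t ht

theorem measurable_uncurry_pd (hm : Measurable fun q : ℝ × V3 => u q.1 q.2)
    (hd : ∀ t, Differentiable ℝ (u t)) (j : Fin 3) :
    Measurable fun q : ℝ × V3 => pd j (u q.1) q.2 := by
  refine measurable_of_tendsto_metrizable (f := fun (n : ℕ) (q : ℝ × V3) =>
    (n : ℝ) • (u q.1 (q.2 + (n : ℝ)⁻¹ • (Pi.single j 1 : V3)) - u q.1 q.2)) (fun n => ?_) ?_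
  · have h : Measurable fun q : ℝ × V3 => (q.1, q.2 + (n : ℝ)⁻¹ • (Pi.single j 1 : V3)) :=
      measurable_fst.prodMk (measurable_snd.add_const _)
    exact ((hm.comp h).sub hm).const_smul (n : ℝ)
  · refine tendsto_pi_nhds.2 fun q => ?_
    exact ((hd q.1 q.2).hasFDerivAt.lim_real (Pi.single j 1 : V3)).comp
      tendsto_natCast_atTop_atTop

theorem UniformlySchwartzOn.exists_measurable_H2sq (hs : MeasurableSet s)
    (hu : UniformlySchwartzOn s u)
    (hc : ContinuousOn (fun q : ℝ × V3 => u q.1 q.2) (s ×ˢ univ)) :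
    ∃ h : ℝ → ℝ, Measurable h ∧ ∀ t ∈ s, H2sq (u t) = h t := by
  classical
  let v : ℝ → V3 → Fin 3 → ℝ := fun t => if t ∈ s then u t else 0
  have hv : ∀ t ∈ s, v t = u t := fun t ht => if_pos ht
  have hsmooth : ∀ t, ContDiff ℝ (⊤ : ℕ∞) (v t) := by
    intro t
    by_cases ht : t ∈ s
    · rw [hv t ht]; exact hu.1 t ht
    · simp only [v, if_neg ht]; exact contDiff_const
  have hm : Measurable fun q : ℝ × V3 => v q.1 q.2 := by
    have h := hc.measurable_piecewise (continuousOn_const (c := 0)) (hs.prod MeasurableSet.univ)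
    convert h using 1
    ext q : 1
    by_cases hq : q.1 ∈ s <;> simp [v, Set.piecewise, hq]
  have hd2 : ∀ j t, Differentiable ℝ (_root_.pd j (v t)) := by
    intro j t
    have h (n : ℕ) : ContDiff ℝ n (fderiv ℝ (v t)) :=
      (hsmooth t).fderiv_right (by exact_mod_cast le_top)
    exact ((h 1).clm_apply contDiff_const).differentiable (by simp)
  have hm2 : ∀ j k, Measurable fun q : ℝ × V3 => _root_.pd k (_root_.pd j (v q.1)) q.2 :=
    fun j k => measurable_uncurry_pd
      (measurable_uncurry_pd hm (fun t => (hsmooth t).differentiable (by simp)) j) (hd2 j) k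
  refine ⟨fun t => H2sq (v t), ?_, fun t ht => by simp only [hv t ht]⟩
  have hF : Measurable fun q : ℝ × V3 =>
      ∑ i, ∑ j, ∑ k, (_root_.pd k (_root_.pd j (v q.1)) q.2 i) ^ 2 :=
    Finset.measurable_sum _ fun i _ => Finset.measurable_sum _ fun j _ =>
      Finset.measurable_sum _ fun k _ => ((measurable_pi_iff.1 (hm2 j k)) i).pow_const 2
  exact hF.stronglyMeasurable.integral_prod_right'.measurable

/-- Cauchy–Schwarz on a bounded time interval. -/
theorem integral_sqrt_le {T : ℝ} (hT : 0 < T) {h : ℝ → ℝ} (h0 : ∀ t ∈ Ioc 0 T, 0 ≤ h t)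
    (hi : IntegrableOn h (Ioc 0 T)) (hi' : IntegrableOn (fun t => √(h t)) (Ioc 0 T)) :
    ∫ t in Ioc 0 T, √(h t) ≤ √T * √(∫ t in Ioc 0 T, h t) := by
  set I := ∫ t in Ioc 0 T, √(h t)
  set J := ∫ t in Ioc 0 T, h t
  have key : 0 ≤ ∫ t in Ioc 0 T, (h t - 2 * (I / T) * √(h t) + (I / T) ^ 2) := by
    refine setIntegral_nonneg measurableSet_Ioc fun t ht => ?_
    nlinarith [sq_nonneg (√(h t) - I / T), Real.sq_sqrt (h0 t ht)]
  have hconst : IntegrableOn (fun _ : ℝ => (I / T) ^ 2) (Ioc 0 T) :=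
    integrableOn_const (by simp)
  have hlin : IntegrableOn (fun t => 2 * (I / T) * √(h t)) (Ioc 0 T) := hi'.const_mul _
  have hdiff : IntegrableOn (fun t => h t - 2 * (I / T) * √(h t)) (Ioc 0 T) := hi.sub hlin
  rw [integral_add hdiff hconst, integral_sub hi hlin,
    integral_const_mul, setIntegral_const] at key
  simp only [measureReal_def, Real.volume_Ioc, sub_zero, ENNReal.toReal_ofReal hT.le,
    smul_eq_mul] at key
  change 0 ≤ J - 2 * (I / T) * I + T * (I / T) ^ 2 at key
  have e : J - 2 * (I / T) * I + T * (I / T) ^ 2 = J - I ^ 2 / T := by field_simp; ring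
  rw [e, sub_nonneg, div_le_iff₀ hT] at key
  rw [← Real.sqrt_mul hT.le, mul_comm]
  exact Real.le_sqrt_of_sq_le key

theorem H2sq_nonneg (g : V3 → Fin 3 → ℝ) : 0 ≤ H2sq g :=
  integral_nonneg fun _ => Finset.sum_nonneg fun _ _ => Finset.sum_nonneg fun _ _ =>
    Finset.sum_nonneg fun _ _ => sq_nonneg _

theorem L2sq_nonneg (g : V3 → Fin 3 → ℝ) : 0 ≤ L2sq g :=
  integral_nonneg fun _ => Finset.sum_nonneg fun _ _ => sq_nonneg _

/-- Product estimate for the tensor product `u ⊗ u` in `L²_t Ḣ¹_x`. -/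
theorem tensor_product_estimate :
    ∃ c : ℝ, 0 < c ∧
    ∀ (T : ℝ), 0 < T →
    ∀ u : ℝ → V3 → Fin 3 → ℝ,
      ContinuousOn (fun q : ℝ × V3 => u q.1 q.2) (Set.Icc (0:ℝ) T ×ˢ Set.univ) →
      (∀ t ∈ Set.Icc (0:ℝ) T, ContDiff ℝ (⊤ : ℕ∞) (u t)) →
      (∀ (k n : ℕ), ∃ C : ℝ, ∀ t ∈ Set.Icc (0:ℝ) T, ∀ x : V3,
        ‖x‖ ^ k * ‖iteratedFDeriv ℝ n (u t) x‖ ≤ C) →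
      Real.sqrt (∫ t in (0:ℝ)..T,
          ∫ x : V3, ∑ i, ∑ j, ∑ k, (pdS k (fun y => u t y i * u t y j) x)^2)
        ≤ c * T ^ ((1:ℝ)/4) *
          ((⨆ t : Set.Icc (0:ℝ) T, Real.sqrt (L2sq (u t) + H1sq (u t)))
            + Real.sqrt (∫ t in (0:ℝ)..T, H2sq (u t)))^2 := by
  obtain ⟨K, hK, hspace⟩ := exists_tensor_H1_le
  refine ⟨√K, Real.sqrt_pos.2 hK, fun T hT u hc hsm hbd => ?_⟩
  have hu : UniformlySchwartzOn (Icc 0 T) u := ⟨hsm, hbd⟩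
  obtain ⟨B₀, hB₀⟩ := hu.exists_L2sq_le
  obtain ⟨B₁, hB₁⟩ := hu.exists_H1sq_le
  obtain ⟨B₂, hB₂⟩ := hu.exists_H2sq_le
  obtain ⟨h, hmeas, hh⟩ := hu.exists_measurable_H2sq measurableSet_Icc hc
  set A := ⨆ t : Icc (0 : ℝ) T, √(L2sq (u t) + H1sq (u t))
  have hbdd : BddAbove (range fun t : Icc (0 : ℝ) T => √(L2sq (u t) + H1sq (u t))) := by
    refine ⟨√(B₀ + B₁), ?_⟩
    rintro _ ⟨t, rfl⟩
    exact Real.sqrt_le_sqrt (add_le_add (hB₀ t t.2) (hB₁ t t.2))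
  have hA : ∀ t ∈ Icc 0 T, √(H1sq (u t)) ≤ A := fun t ht =>
    (Real.sqrt_le_sqrt (le_add_of_nonneg_left (L2sq_nonneg _))).trans (le_ciSup hbdd ⟨t, ht⟩)
  have hA0 : 0 ≤ A := (Real.sqrt_nonneg _).trans (hA 0 ⟨le_rfl, hT.le⟩)
  have hsub : Ioc 0 T ⊆ Icc 0 T := Ioc_subset_Icc_self
  have hInt : ∀ f : ℝ → ℝ, Measurable f → (∃ B, ∀ t ∈ Icc 0 T, |f t| ≤ B) →
      IntegrableOn f (Ioc 0 T) := by
    rintro f hf ⟨B, hB⟩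
    exact Measure.integrableOn_of_bounded (M := B) (by simp) hf.aestronglyMeasurable
      (ae_restrict_of_forall_mem measurableSet_Ioc fun t ht => hB t (hsub ht))
  have hh0 : ∀ t ∈ Icc 0 T, 0 ≤ h t := fun t ht => hh t ht ▸ H2sq_nonneg _
  have hhB : ∀ t ∈ Icc 0 T, h t ≤ B₂ := fun t ht => hh t ht ▸ hB₂ t ht
  have hi : IntegrableOn h (Ioc 0 T) :=
    hInt h hmeas ⟨B₂, fun t ht => by rw [abs_of_nonneg (hh0 t ht)]; exact hhB t ht⟩
  have hi' : IntegrableOn (fun t => √(h t)) (Ioc 0 T) :=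
    hInt _ hmeas.sqrt ⟨√B₂, fun t ht => by
      rw [abs_of_nonneg (Real.sqrt_nonneg _)]; exact Real.sqrt_le_sqrt (hhB t ht)⟩
  rw [intervalIntegral.integral_of_le hT.le, intervalIntegral.integral_of_le hT.le,
    setIntegral_congr_fun measurableSet_Ioc fun t ht => hh t (hsub ht)]
  set D := √(∫ t in Ioc 0 T, h t)
  have hD0 : 0 ≤ D := Real.sqrt_nonneg _
  have hmain : ∫ t in Ioc 0 T, ∫ x : V3, ∑ i, ∑ j, ∑ k, (pdS k (fun y => u t y i * u t y j) x) ^ 2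
      ≤ K * A ^ 3 * (√T * D) := by
    refine le_trans ?_ (mul_le_mul_of_nonneg_left
      (integral_sqrt_le hT (fun t ht => hh0 t (hsub ht)) hi hi') (by positivity))
    rw [← integral_const_mul]
    refine integral_mono_of_nonneg (ae_of_all _ fun t => integral_nonneg fun x =>
      Finset.sum_nonneg fun _ _ => Finset.sum_nonneg fun _ _ => Finset.sum_nonneg fun _ _ =>
        sq_nonneg _) (hi'.const_mul _)
      (ae_restrict_of_forall_mem measurableSet_Ioc fun t ht => ?_)
    refine (hspace (u t) (hu.isSchwartz (hsub ht))).trans ?_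
    have h3 : H1sq (u t) * √(H1sq (u t)) = √(H1sq (u t)) ^ 3 := by
      rw [pow_succ, Real.sq_sqrt (H1sq_nonneg _)]
    simp only [← hh t (hsub ht), h3, mul_assoc]
    gcongr
    exact hA t (hsub ht)
  rw [Real.sqrt_le_left (by positivity)]
  refine hmain.trans ?_
  have hT4 : (T ^ ((1 : ℝ) / 4)) ^ 2 = √T := by
    rw [← Real.rpow_natCast, ← Real.rpow_mul hT.le, Real.sqrt_eq_rpow]
    norm_num
  have hAD : A ^ 3 * D ≤ (A + D) ^ 4 := by
    calc A ^ 3 * D ≤ (A + D) ^ 3 * (A + D) := by gcongr <;> linarith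
      _ = _ := by ring
  calc K * A ^ 3 * (√T * D) = K * √T * (A ^ 3 * D) := by ring
    _ ≤ K * √T * (A + D) ^ 4 := by gcongr
    _ = _ := by rw [mul_pow, mul_pow, Real.sq_sqrt hK.le, hT4]; ring

end
end
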